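/- arXiv:cs/0607026 — 13 statements merged into one kernel-verified Lean document; each statement's English description precedes it below -/
import Mathlib

section
/- Let n ≥ 2 and m ≥ 2, and let A be any path-independent load-balancing algorithm for n jobs and m machines. Then there exist a two-element state S = {1,2} and a one-element state T ⊆ S such that in the infinite execution that alternates S, T, S, T, ..., the algorithm A pays reassignment cost at least 1 at every step (so its total reassignment cost over the first t steps is at least t), while there exists another path-independent load-balancing algorithm A* whose total reassignment cost over every prefix of the same execution is 0. Consequently A is not (α,β)-competitive for any finite α and β. -/
/-- For any path-independent load-balancing algorithm `A` on `n ≥ 2` jobs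
and `m ≥ 2` machines, there are a two-element state `S` and a one-element state `T ⊆ S`
such that, in the alternating execution `S, T, S, T, …`, `A` pays reassignment cost at
least `1` at every step (so its total cost over the first `t` steps is at least `t`),
while some other path-independent algorithm `B` pays total reassignment cost `0` over
every prefix of that execution. -/
theorem no_bicriteria_competitive_algorithm
    (n m : ℕ) (hn : 2 ≤ n) (hm : 2 ≤ m)
    (A : Finset (Fin m) → Fin n → Fin m)
    (hA : ∀ S : Finset (Fin m), S.Nonempty → ∀ j, A S j ∈ S) :
    ∃ S T : Finset (Fin m), T ⊆ S ∧ S.card = 2 ∧ T.card = 1 ∧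
      (∀ i : ℕ, 1 ≤ (Finset.univ.filter (fun j : Fin n =>
          A (if Even i then S else T) j ≠ A (if Even (i + 1) then S else T) j)).card) ∧
      (∀ t : ℕ, t ≤ ∑ i ∈ Finset.range t,
          (Finset.univ.filter (fun j : Fin n =>
            A (if Even i then S else T) j ≠ A (if Even (i + 1) then S else T) j)).card) ∧
      ∃ B : Finset (Fin m) → Fin n → Fin m,
        (∀ U : Finset (Fin m), U.Nonempty → ∀ j, B U j ∈ U) ∧
        (∀ t : ℕ, ∑ i ∈ Finset.range t,
          (Finset.univ.filter (fun j : Fin n =>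
            B (if Even i then S else T) j ≠ B (if Even (i + 1) then S else T) j)).card = 0) := by
  obtain ⟨x, y, hxy, hy⟩ : ∃ x y : Fin m, x ≠ y ∧ A {x, y} ⟨0, by omega⟩ = y := by
    let p : Fin m := ⟨0, by omega⟩
    let q : Fin m := ⟨1, by omega⟩
    have hpq : p ≠ q := by simp [p, q]
    have h := hA {p, q} (Finset.insert_nonempty _ _) ⟨0, by omega⟩
    rcases Finset.mem_insert.mp h with h | h
    · exact ⟨q, p, hpq.symm, by rwa [Finset.pair_comm]⟩
    · exact ⟨p, q, hpq, Finset.mem_singleton.mp h⟩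
  have hx : A {x} ⟨0, by omega⟩ = x :=
    Finset.mem_singleton.mp (hA {x} (Finset.singleton_nonempty x) _)
  have hstep : ∀ i : ℕ, 1 ≤ (Finset.univ.filter (fun j : Fin n =>
      A (if Even i then {x, y} else {x}) j ≠ A (if Even (i + 1) then {x, y} else {x}) j)).card := by
    intro i
    refine Finset.card_pos.mpr ⟨⟨0, by omega⟩, ?_⟩
    by_cases hi : Even i <;> simp [hi, Nat.even_add_one, hx, hy, hxy, hxy.symm]
  refine ⟨{x, y}, {x}, by simp, Finset.card_pair hxy, Finset.card_singleton x, hstep,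
    fun t => ?_, ?_⟩
  · simpa using Finset.card_nsmul_le_sum (Finset.range t) _ 1 fun i _ => hstep i
  · classical
    refine ⟨fun U _ => if x ∈ U then x else if h : U.Nonempty then h.choose else x, ?_, ?_⟩
    · intro U hU j
      by_cases hxU : x ∈ U
      · simp [hxU]
      · simpa [hxU, hU] using hU.choose_spec
    · intro t
      have hmem : ∀ i : ℕ, x ∈ (if Even i then {x, y} else {x} : Finset (Fin m)) := by
        intro i
        split_ifs <;> simp
      simp [hmem]
end

section
/- Consider a system of m machines and n = k·m! identical jobs for some positive integer k. Let A be a path-independent load-balancing algorithm that, for every nonempty state S ⊆ {1,...,m}, assigns exactly n/|S| jobs to each machine in S. Then for all nonempty states S and T, the number of jobs reassigned by A going from S to T satisfies r_A(S,T) ≥ n·(1 − |S∩T|/max(|S|,|T|)). -/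
/-- If two functions only agree at values in `U`, and the fibres of `f` over `U` have at most `c`
elements, then `f` and `g` agree in at most `c * |U|` places. -/
theorem card_filter_eq_le_mul_card {α β : Type*} [Fintype α] [DecidableEq β] (f g : α → β)
    (U : Finset β) (c : ℕ) (hU : ∀ j, f j = g j → f j ∈ U)
    (hc : ∀ i ∈ U, (Finset.univ.filter (fun j => f j = i)).card ≤ c) :
    (Finset.univ.filter (fun j => f j = g j)).card ≤ c * U.card := by
  refine Finset.card_le_mul_card_image_of_maps_to (f := f) (fun j hj => ?_) c (fun i hi => ?_)
  · exact hU j (Finset.mem_filter.mp hj).2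
  · refine le_trans (Finset.card_le_card fun j hj => ?_) (hc i hi)
    simp only [Finset.mem_filter, Finset.mem_univ, true_and] at hj ⊢
    exact hj.2

/-- With `n = k·m!` identical jobs, any path-independent algorithm that
assigns exactly `n/|S|` jobs to each machine of every nonempty state `S` reassigns at
least `n·(1 − |S∩T|/max(|S|,|T|))` jobs going from state `S` to state `T`. -/
theorem balanced_algorithm_reassignment_lower_bound
    (m k n : ℕ) (hk : 0 < k) (hn : n = k * Nat.factorial m)
    (A : Finset (Fin m) → Fin n → Fin m)
    (hA : ∀ S : Finset (Fin m), S.Nonempty → ∀ j, A S j ∈ S)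
    (hbal : ∀ S : Finset (Fin m), S.Nonempty → ∀ i ∈ S,
      (Finset.univ.filter (fun j : Fin n => A S j = i)).card = n / S.card)
    (S T : Finset (Fin m)) (hS : S.Nonempty) (hT : T.Nonempty) :
    (n : ℝ) * (1 - ((S ∩ T).card : ℝ) / (max S.card T.card : ℕ)) ≤
      ((Finset.univ.filter (fun j : Fin n => A S j ≠ A T j)).card : ℝ) := by
  have hmem : ∀ j, A S j = A T j → A S j ∈ S ∩ T := fun j hj =>
    Finset.mem_inter.mpr ⟨hA S hS j, hj ▸ hA T hT j⟩
  have hagree : (Finset.univ.filter (fun j : Fin n => A S j = A T j)).card ≤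
      n / max S.card T.card * (S ∩ T).card := by
    rcases max_choice S.card T.card with h | h <;> rw [h]
    · exact card_filter_eq_le_mul_card _ _ _ _ hmem
        fun i hi => (hbal S hS i (Finset.mem_inter.mp hi).1).le
    · simp only [eq_comm (a := A S _)]
      exact card_filter_eq_le_mul_card _ _ _ _ (fun j hj => hj ▸ hmem j hj.symm)
        fun i hi => (hbal T hT i (Finset.mem_inter.mp hi).2).le
  have hsplit : (Finset.univ.filter (fun j : Fin n => A S j = A T j)).card +
      (Finset.univ.filter (fun j : Fin n => A S j ≠ A T j)).card = n := by
    simpa using Finset.card_filter_add_card_filter_not (s := (Finset.univ : Finset (Fin n)))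
      (fun j => A S j = A T j)
  have hagree_real : ((Finset.univ.filter (fun j : Fin n => A S j = A T j)).card : ℝ) ≤
      (n : ℝ) / (max S.card T.card : ℕ) * (S ∩ T).card :=
    calc _ ≤ ((n / max S.card T.card : ℕ) : ℝ) * (S ∩ T).card := by exact_mod_cast hagree
      _ ≤ _ := by gcongr; exact Nat.cast_div_le
  have hsplit_real : ((Finset.univ.filter (fun j : Fin n => A S j = A T j)).card : ℝ) +
      (Finset.univ.filter (fun j : Fin n => A S j ≠ A T j)).card = n := by exact_mod_cast hsplit
  rw [mul_sub, mul_one, mul_div_left_comm, mul_comm _ ((n : ℝ) / _)]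
  linarith
end

section
/- Let A be any path-independent load-balancing algorithm for n jobs and m machines, and let ρ be a permutation of {1,...,m} chosen uniformly at random. Define the algorithm ρ⁻¹Aρ by (ρ⁻¹Aρ)_S(j) = ρ⁻¹(A_{ρ(S)}(j)). Then for all nonempty states S and T, the expected reassignment cost of ρ⁻¹Aρ going from S to T satisfies (1/m!)·Σ_{ρ} |{j : A_{ρ(S)}(j) ≠ A_{ρ(T)}(j)}| ≥ n·(1 − |S∩T|/max(|S|,|T|)). -/
open Finset in
/-- Along a uniformly random permutation, the preimage of the element chosen from the image of `S`
is equally likely to be each element of `S`. -/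
theorem card_perm_choice_eq {α : Type*} [Fintype α] [DecidableEq α] (f : Finset α → α)
    (S : Finset α) {x y : α} (hx : x ∈ S) (hy : y ∈ S) :
    (univ.filter fun ρ : Equiv.Perm α => f (S.image ρ) = ρ x).card =
      (univ.filter fun ρ : Equiv.Perm α => f (S.image ρ) = ρ y).card := by
  have hS : S.image (Equiv.swap x y) = S := by
    refine eq_of_subset_of_card_le (fun z hz => ?_) ?_
    · obtain ⟨w, hw, rfl⟩ := mem_image.1 hz
      rw [Equiv.swap_apply_def]
      split_ifs <;> assumption
    · rw [card_image_of_injective _ (Equiv.injective _)]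
  have himg (ρ : Equiv.Perm α) : S.image (ρ * Equiv.swap x y) = S.image ρ := by
    rw [Equiv.Perm.coe_mul, ← image_image, hS]
  refine card_equiv (Equiv.mulRight (Equiv.swap x y)) fun ρ => ?_
  simp only [mem_filter, mem_univ, true_and, Equiv.coe_mulRight, himg, Equiv.Perm.mul_apply,
    Equiv.swap_apply_right]

open Finset in
theorem card_perm_choice_mem_image {α : Type*} [Fintype α] [DecidableEq α] (f : Finset α → α)
    (hf : ∀ S : Finset α, S.Nonempty → f S ∈ S) {S U : Finset α} (hS : S.Nonempty)
    (hU : U ⊆ S) :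
    S.card * (univ.filter fun ρ : Equiv.Perm α => f (S.image ρ) ∈ U.image ρ).card =
      U.card * (Fintype.card α).factorial := by
  obtain ⟨x, hx⟩ := hS
  have key (V : Finset α) (hV : V ⊆ S) :
      (univ.filter fun ρ : Equiv.Perm α => f (S.image ρ) ∈ V.image ρ).card =
        V.card * (univ.filter fun ρ : Equiv.Perm α => f (S.image ρ) = ρ x).card := by
    have h : (univ.filter fun ρ : Equiv.Perm α => f (S.image ρ) ∈ V.image ρ) =
        V.biUnion fun y => univ.filter fun ρ : Equiv.Perm α => f (S.image ρ) = ρ y := by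
      ext ρ
      simp [eq_comm]
    rw [h, card_biUnion, sum_const_nat fun y hy => card_perm_choice_eq f S (hV hy) hx]
    intro y _ z _ hyz
    refine disjoint_filter.2 fun ρ _ h₁ h₂ => hyz (ρ.injective (h₁.symm.trans h₂))
  have hall := key S subset_rfl
  rw [filter_true_of_mem fun ρ _ => hf _ (Nonempty.image ⟨x, hx⟩ _), card_univ,
    Fintype.card_perm] at hall
  rw [key U hU, hall]
  ring

open Finset in
theorem card_perm_choice_agree_le {α : Type*} [Fintype α] [DecidableEq α] (f : Finset α → α)
    (hf : ∀ S : Finset α, S.Nonempty → f S ∈ S) {S T : Finset α} (hS : S.Nonempty)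
    (hT : T.Nonempty) :
    max S.card T.card * (univ.filter fun ρ : Equiv.Perm α => f (S.image ρ) = f (T.image ρ)).card ≤
      (S ∩ T).card * (Fintype.card α).factorial := by
  have hmem (ρ : Equiv.Perm α) (h : f (S.image ρ) = f (T.image ρ)) :
      f (S.image ρ) ∈ (S ∩ T).image ρ := by
    rw [image_inter _ _ ρ.injective, mem_inter]
    exact ⟨hf _ (hS.image _), h ▸ hf _ (hT.image _)⟩
  rcases max_choice S.card T.card with h | h <;> rw [h]
  · rw [← card_perm_choice_mem_image f hf hS inter_subset_left]
    gcongr with ρ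
    exact hmem ρ
  · rw [← card_perm_choice_mem_image f hf hT inter_subset_right]
    gcongr with ρ
    exact fun h => h ▸ hmem ρ h


/-- For any path-independent algorithm `A`, if the machine names are permuted
by a uniformly random permutation `ρ`, the expected reassignment cost of the conjugated
algorithm `ρ⁻¹Aρ` going from state `S` to state `T` is at least
`n·(1 − |S∩T|/max(|S|,|T|))`. -/
theorem randomized_reassignment_lower_bound
    (n m : ℕ)
    (A : Finset (Fin m) → Fin n → Fin m)
    (hA : ∀ S : Finset (Fin m), S.Nonempty → ∀ j, A S j ∈ S)
    (S T : Finset (Fin m)) (hS : S.Nonempty) (hT : T.Nonempty) :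
    (n : ℝ) * (1 - ((S ∩ T).card : ℝ) / (max S.card T.card : ℕ)) ≤
      (1 / (Nat.factorial m : ℝ)) * ∑ ρ : Equiv.Perm (Fin m),
        ((Finset.univ.filter (fun j : Fin n =>
          A (S.image ρ) j ≠ A (T.image ρ) j)).card : ℝ) := by
  have hM : (0 : ℝ) < (max S.card T.card : ℕ) := by
    exact_mod_cast lt_max_of_lt_left hS.card_pos
  have hm : (0 : ℝ) < Nat.factorial m := by exact_mod_cast Nat.factorial_pos m
  have hjob (j : Fin n) : (Nat.factorial m : ℝ) *
      (1 - ((S ∩ T).card : ℝ) / (max S.card T.card : ℕ)) ≤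
      (Finset.univ.filter fun ρ : Equiv.Perm (Fin m) =>
        A (S.image ρ) j ≠ A (T.image ρ) j).card := by
    have hle := card_perm_choice_agree_le (fun U => A U j) (fun U hU => hA U hU j) hS hT
    have hsplit := Finset.card_filter_add_card_filter_not (s := Finset.univ)
      (fun ρ : Equiv.Perm (Fin m) => A (S.image ρ) j = A (T.image ρ) j)
    rw [Finset.card_univ, Fintype.card_perm, Fintype.card_fin] at hsplit
    rw [Fintype.card_fin] at hle
    rify at hle hsplit
    push_cast at hM ⊢
    rw [one_sub_div hM.ne', mul_div_assoc', div_le_iff₀ hM]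
    simp only [ne_eq]
    rw [← eq_sub_iff_add_eq'] at hsplit
    rw [hsplit]
    linarith
  have hswap : ∑ ρ : Equiv.Perm (Fin m), ((Finset.univ.filter (fun j : Fin n =>
      A (S.image ρ) j ≠ A (T.image ρ) j)).card : ℝ) =
      ∑ j : Fin n, ((Finset.univ.filter fun ρ : Equiv.Perm (Fin m) =>
        A (S.image ρ) j ≠ A (T.image ρ) j).card : ℝ) := by
    exact_mod_cast Finset.sum_card_bipartiteAbove_eq_sum_card_bipartiteBelow
      (fun (ρ : Equiv.Perm (Fin m)) (j : Fin n) => A (S.image ρ) j ≠ A (T.image ρ) j)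
  have hsum := Finset.sum_le_sum fun j (_ : j ∈ Finset.univ) => hjob j
  rw [Finset.sum_const, Finset.card_univ, Fintype.card_fin, nsmul_eq_mul] at hsum
  rw [hswap, one_div_mul_eq_div, le_div_iff₀ hm]
  linarith
end

section
/- Let A be any path-independent load-balancing algorithm for n jobs and m machines, let S and T be nonempty states, and let j be any fixed job. If ρ is a permutation of {1,...,m} chosen uniformly at random, then the probability that A_{ρ(S)}(j) = A_{ρ(T)}(j) is at most |S∩T|/|S|, and symmetrically at most |S∩T|/|T|; hence it is at most |S∩T|/max(|S|,|T|). -/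
open Finset in
/-- Under a uniformly random permutation `ρ`, the preimage under `ρ` of the element selected from
`ρ(S)` is equally likely to be any two given elements of `S`. -/
theorem card_filter_symm_choice_eq {α : Type*} [Fintype α] [DecidableEq α]
    (f : Finset α → α) {S : Finset α} {s t : α} (hs : s ∈ S) (ht : t ∈ S) :
    #{ρ : Equiv.Perm α | ρ.symm (f (S.image ρ)) = s} =
      #{ρ : Equiv.Perm α | ρ.symm (f (S.image ρ)) = t} := by
  have hswap : S.image (Equiv.swap s t) = S := by
    refine eq_of_subset_of_card_le (image_subset_iff.2 fun x hx => ?_)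
      (card_image_of_injective _ (Equiv.injective _)).ge
    rw [Equiv.swap_apply_def]
    split_ifs <;> assumption
  refine card_equiv (Equiv.mulRight (Equiv.swap s t)) fun ρ => ?_
  have himage : S.image (ρ ∘ Equiv.swap s t) = S.image ρ := by
    rw [← image_image, hswap]
  simp only [mem_filter, mem_univ, true_and, Equiv.coe_mulRight, Equiv.Perm.coe_mul, himage,
    Equiv.symm_apply_eq, Function.comp_apply, Equiv.swap_apply_right]

open Finset in
/-- Under a uniformly random permutation `ρ`, the preimage under `ρ` of the element selected from
`ρ(S)` is uniformly distributed on `S`. -/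
theorem card_filter_symm_choice_mem_mul_card {α : Type*} [Fintype α] [DecidableEq α]
    (f : Finset α → α) (hf : ∀ S : Finset α, S.Nonempty → f S ∈ S)
    {S U : Finset α} (hS : S.Nonempty) (hU : U ⊆ S) :
    #{ρ : Equiv.Perm α | ρ.symm (f (S.image ρ)) ∈ U} * #S = #U * (Fintype.card α).factorial := by
  obtain ⟨s, hs⟩ := hS
  have hcard : ∀ V ⊆ S, #{ρ : Equiv.Perm α | ρ.symm (f (S.image ρ)) ∈ V} =
      #V * #{ρ : Equiv.Perm α | ρ.symm (f (S.image ρ)) = s} := by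
    intro V hV
    rw [card_eq_sum_card_fiberwise (t := V) (f := fun ρ : Equiv.Perm α => ρ.symm (f (S.image ρ)))
      (fun ρ hρ => by simpa using hρ), ← smul_eq_mul, ← sum_const]
    refine sum_congr rfl fun v hv => ?_
    rw [← card_filter_symm_choice_eq f (hV hv) hs, filter_filter]
    congr 1
    ext ρ
    simp only [mem_filter, mem_univ, true_and]
    exact ⟨fun h => h.2, fun h => ⟨h ▸ hv, h⟩⟩
  have htotal : #{ρ : Equiv.Perm α | ρ.symm (f (S.image ρ)) ∈ S} =
      (Fintype.card α).factorial := by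
    rw [← Fintype.card_perm, ← card_univ, filter_true_of_mem]
    intro ρ _
    obtain ⟨x, hx, hxρ⟩ := mem_image.1 (hf (S.image ρ) (image_nonempty.2 ⟨s, hs⟩))
    rwa [← hxρ, Equiv.symm_apply_apply]
  rw [← htotal, hcard U hU, hcard S Subset.rfl]
  ring

open Finset in
/-- Under a uniformly random permutation `ρ`, the probability that the same element is selected
from `ρ(S)` and `ρ(T)` is at most `|S ∩ T| / |S|`. -/
theorem card_filter_choice_image_eq_div_le {α : Type*} [Fintype α] [DecidableEq α]
    (f : Finset α → α) (hf : ∀ S : Finset α, S.Nonempty → f S ∈ S)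
    {S T : Finset α} (hS : S.Nonempty) (hT : T.Nonempty) :
    (#{ρ : Equiv.Perm α | f (S.image ρ) = f (T.image ρ)} : ℝ) / (Fintype.card α).factorial ≤
      (#(S ∩ T) : ℝ) / #S := by
  have hsub : #{ρ : Equiv.Perm α | f (S.image ρ) = f (T.image ρ)} ≤
      #{ρ : Equiv.Perm α | ρ.symm (f (S.image ρ)) ∈ S ∩ T} := by
    refine card_le_card (monotone_filter_right _ fun ρ _ hρ => ?_)
    obtain ⟨x, hx, hxρ⟩ := mem_image.1 (hf (S.image ρ) (hS.image ρ))
    obtain ⟨y, hy, hyρ⟩ := mem_image.1 (hf (T.image ρ) (hT.image ρ))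
    obtain rfl : x = y := ρ.injective (hxρ.trans (hρ.trans hyρ.symm))
    rw [← hxρ, Equiv.symm_apply_apply]
    exact mem_inter.2 ⟨hx, hy⟩
  rw [div_le_div_iff₀ (by exact_mod_cast Nat.factorial_pos _) (by exact_mod_cast hS.card_pos)]
  exact_mod_cast (Nat.mul_le_mul_right _ hsub).trans
    (card_filter_symm_choice_mem_mul_card f hf hS inter_subset_left).le


/-- For any path-independent algorithm `A`, states `S`, `T`, a fixed job `j`,
and a uniformly random permutation `ρ` of the machines, the probability that
`A_{ρS}(j) = A_{ρT}(j)` is at most `|S∩T|/|S|`, at most `|S∩T|/|T|`, and hence at most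
`|S∩T|/max(|S|,|T|)`. -/
theorem stay_probability_upper_bound
    (n m : ℕ)
    (A : Finset (Fin m) → Fin n → Fin m)
    (hA : ∀ S : Finset (Fin m), S.Nonempty → ∀ j, A S j ∈ S)
    (S T : Finset (Fin m)) (hS : S.Nonempty) (hT : T.Nonempty) (j : Fin n) :
    (((Finset.univ.filter (fun ρ : Equiv.Perm (Fin m) =>
        A (S.image ρ) j = A (T.image ρ) j)).card : ℝ) / (Nat.factorial m : ℝ)
          ≤ ((S ∩ T).card : ℝ) / (S.card : ℝ)) ∧
    (((Finset.univ.filter (fun ρ : Equiv.Perm (Fin m) =>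
        A (S.image ρ) j = A (T.image ρ) j)).card : ℝ) / (Nat.factorial m : ℝ)
          ≤ ((S ∩ T).card : ℝ) / (T.card : ℝ)) ∧
    (((Finset.univ.filter (fun ρ : Equiv.Perm (Fin m) =>
        A (S.image ρ) j = A (T.image ρ) j)).card : ℝ) / (Nat.factorial m : ℝ)
          ≤ ((S ∩ T).card : ℝ) / ((max S.card T.card : ℕ) : ℝ)) := by
  have hleft := card_filter_choice_image_eq_div_le (fun S => A S j) (fun S hS => hA S hS j) hS hT
  have hright := card_filter_choice_image_eq_div_le (fun S => A S j) (fun S hS => hA S hS j) hT hS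
  simp only [Fintype.card_fin] at hleft hright
  simp only [eq_comm (a := A (T.image _) j), Finset.inter_comm T S] at hright
  refine ⟨hleft, hright, ?_⟩
  rcases max_choice S.card T.card with h | h <;> rw [h] <;> assumption
end

section
/- For each job j ∈ {1,...,n}, let σ_j be a permutation of the machines {1,...,m}, and let ρ be a permutation of {1,...,m} chosen uniformly at random. Consider the preference-based algorithm that in state S assigns job j to the unique machine i ∈ S minimizing σ_j(ρ(i)). Then for all nonempty states S and T, the expected number of jobs j whose assigned machine in state S differs from their assigned machine in state T equals n·(1 − |S∩T|/|S∪T|). -/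
open Finset in
/-- Any two elements of `U` are equally likely to be the minimizer over `U` of a function composed
with a random permutation. -/
theorem card_perm_isMinOn_eq {α β : Type*} [Fintype α] [DecidableEq α] [LinearOrder β]
    (τ : α → β) {U : Finset α} {i k : α} (hi : i ∈ U) (hk : k ∈ U) :
    #{ρ : Equiv.Perm α | ∀ x ∈ U, τ (ρ i) ≤ τ (ρ x)} =
      #{ρ : Equiv.Perm α | ∀ x ∈ U, τ (ρ k) ≤ τ (ρ x)} := by
  have hswap : ∀ x ∈ U, Equiv.swap i k x ∈ U := by
    intro x hx
    rw [Equiv.swap_apply_def]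
    split_ifs <;> assumption
  refine card_equiv (Equiv.mulRight (Equiv.swap i k)) fun ρ => ?_
  simp only [mem_filter, mem_univ, true_and, Equiv.coe_mulRight, Equiv.Perm.mul_apply,
    Equiv.swap_apply_right]
  refine ⟨fun h x hx => h _ (hswap x hx), fun h x hx => ?_⟩
  simpa using h _ (hswap x hx)

open Finset in
/-- The minimizer over `U` of an injective function composed with a random permutation is
uniformly distributed on `U`. -/
theorem card_perm_minimizer_mem_mul_card {α β : Type*} [Fintype α] [DecidableEq α] [LinearOrder β]
    {τ : α → β} (hτ : Function.Injective τ) {U W : Finset α} (hWU : W ⊆ U)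
    {f : Equiv.Perm α → α} (hfU : ∀ ρ, f ρ ∈ U)
    (hf : ∀ ρ : Equiv.Perm α, ∀ x ∈ U, τ (ρ (f ρ)) ≤ τ (ρ x)) :
    #{ρ : Equiv.Perm α | f ρ ∈ W} * #U = #W * (Fintype.card α).factorial := by
  have key : ∀ i ∈ U, #{ρ | f ρ = i} = #{ρ : Equiv.Perm α | ∀ x ∈ U, τ (ρ i) ≤ τ (ρ x)} := by
    intro i hi
    congr 1
    ext ρ
    simp only [mem_filter, mem_univ, true_and]
    refine ⟨fun h => h ▸ hf ρ, fun h => ?_⟩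
    exact ρ.injective (hτ (le_antisymm (hf ρ i hi) (h _ (hfU ρ))))
  obtain ⟨u, hu⟩ : U.Nonempty := ⟨f 1, hfU 1⟩
  have hcard : ∀ V ⊆ U, #{ρ | f ρ ∈ V} = #V * #{ρ | f ρ = u} := by
    intro V hV
    rw [card_eq_sum_card_fiberwise (f := f) (t := V) (fun ρ hρ => by simpa using hρ),
      ← smul_eq_mul, ← sum_const]
    refine sum_congr rfl fun i hi => ?_
    rw [key u hu, card_perm_isMinOn_eq τ hu (hV hi), ← key i (hV hi), filter_filter]
    congr 1
    ext ρ
    simp only [mem_filter, mem_univ, true_and, and_iff_right_iff_imp]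
    rintro rfl
    exact hi
  have htotal := hcard U Subset.rfl
  rw [filter_true_of_mem fun ρ _ => hfU ρ, card_univ, Fintype.card_perm] at htotal
  rw [hcard W hWU, htotal]
  ring

/-- Two minimizers over `S` and `T` agree iff the minimizer over `S ∪ T` lies in `S ∩ T`. -/
theorem minimizer_eq_iff_minimizer_union_mem_inter {α β : Type*} [DecidableEq α] [LinearOrder β]
    {g : α → β} (hg : Function.Injective g) {S T : Finset α} {a b c : α}
    (ha : a ∈ S ∧ ∀ x ∈ S, g a ≤ g x) (hb : b ∈ T ∧ ∀ x ∈ T, g b ≤ g x)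
    (hc : c ∈ S ∪ T ∧ ∀ x ∈ S ∪ T, g c ≤ g x) : a = b ↔ c ∈ S ∩ T := by
  have hca := hc.2 a (Finset.mem_union_left _ ha.1)
  have hcb := hc.2 b (Finset.mem_union_right _ hb.1)
  have hS : c ∈ S → a = c := fun h => hg (le_antisymm (ha.2 c h) hca)
  have hT : c ∈ T → b = c := fun h => hg (le_antisymm (hb.2 c h) hcb)
  rw [Finset.mem_inter]
  refine ⟨?_, fun h => (hS h.1).trans (hT h.2).symm⟩
  rintro rfl
  rcases Finset.mem_union.1 hc.1 with h | h
  · exact ⟨h, hS h ▸ hb.1⟩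
  · exact ⟨hT h ▸ ha.1, h⟩


/-- For the preference-based algorithm with preference lists `σ_j ∘ ρ`,
where `ρ` is a uniformly random permutation of the machines (each job `j` is assigned,
in state `S`, to the machine `i ∈ S` minimizing `σ_j(ρ(i))`), the expected number of
jobs reassigned between states `S` and `T` equals `n·(1 − |S∩T|/|S∪T|)`. -/
theorem preference_based_expected_reassignment
    (n m : ℕ) (σ : Fin n → Equiv.Perm (Fin m))
    (A : Equiv.Perm (Fin m) → Finset (Fin m) → Fin n → Fin m)
    (hA : ∀ (ρ : Equiv.Perm (Fin m)) (S : Finset (Fin m)), S.Nonempty → ∀ j : Fin n,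
      A ρ S j ∈ S ∧ ∀ i ∈ S, σ j (ρ (A ρ S j)) ≤ σ j (ρ i))
    (S T : Finset (Fin m)) (hS : S.Nonempty) (hT : T.Nonempty) :
    (1 / (Nat.factorial m : ℝ)) * ∑ ρ : Equiv.Perm (Fin m),
        ((Finset.univ.filter (fun j : Fin n => A ρ S j ≠ A ρ T j)).card : ℝ)
      = (n : ℝ) * (1 - ((S ∩ T).card : ℝ) / ((S ∪ T).card : ℝ)) := by
  have hU : (S ∪ T).Nonempty := hS.mono Finset.subset_union_left
  have hU0 : ((S ∪ T).card : ℝ) ≠ 0 := by exact_mod_cast hU.card_pos.ne'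
  have hm0 : (m.factorial : ℝ) ≠ 0 := by exact_mod_cast m.factorial_ne_zero
  have hjob : ∀ j : Fin n,
      ((Finset.univ.filter fun ρ : Equiv.Perm (Fin m) => A ρ S j ≠ A ρ T j).card : ℝ)
        = m.factorial * (1 - ((S ∩ T).card : ℝ) / ((S ∪ T).card : ℝ)) := by
    intro j
    have hagree : (Finset.univ.filter fun ρ : Equiv.Perm (Fin m) => A ρ S j = A ρ T j)
        = Finset.univ.filter fun ρ => A ρ (S ∪ T) j ∈ S ∩ T :=
      Finset.filter_congr fun ρ _ => minimizer_eq_iff_minimizer_union_mem_inter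
        (g := fun i => σ j (ρ i)) ((σ j).injective.comp ρ.injective)
        (hA ρ S hS j) (hA ρ T hT j) (hA ρ _ hU j)
    have hcount := card_perm_minimizer_mem_mul_card (σ j).injective
      (Finset.inter_subset_union (s := S) (t := T))
      (fun ρ => (hA ρ _ hU j).1) (fun ρ => (hA ρ _ hU j).2)
    have hsplit := Finset.card_filter_add_card_filter_not
      (s := (Finset.univ : Finset (Equiv.Perm (Fin m)))) (fun ρ => A ρ S j = A ρ T j)
    rw [← hagree, Fintype.card_fin] at hcount
    rw [Finset.card_univ, Fintype.card_perm, Fintype.card_fin] at hsplit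
    have hcount' := congrArg (Nat.cast (R := ℝ)) hcount
    have hsplit' := congrArg (Nat.cast (R := ℝ)) hsplit
    push_cast at hcount' hsplit'
    field_simp
    linear_combination ((S ∪ T).card : ℝ) * hsplit' - hcount'
  have hswap : ∑ ρ : Equiv.Perm (Fin m),
      ((Finset.univ.filter (fun j : Fin n => A ρ S j ≠ A ρ T j)).card : ℝ)
      = ∑ j : Fin n,
        ((Finset.univ.filter fun ρ : Equiv.Perm (Fin m) => A ρ S j ≠ A ρ T j).card : ℝ) := by
    simp only [Finset.card_filter, Nat.cast_sum]
    exact Finset.sum_comm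
  rw [hswap, Finset.sum_congr rfl fun j _ => hjob j, Finset.sum_const, Finset.card_univ,
    Fintype.card_fin, nsmul_eq_mul]
  field_simp
end

section
/- Let π be a permutation of {1,...,m} chosen uniformly at random, and let S and T be nonempty subsets of {1,...,m}. Then the probability that the machine i ∈ S minimizing π(i) coincides with the machine i ∈ T minimizing π(i) equals |S∩T|/|S∪T|. Equivalently, the number of permutations π of {1,...,m} for which argmin_{i∈S} π(i) = argmin_{i∈T} π(i) equals m!·|S∩T|/|S∪T|. -/
/-- The element of a nonempty finset `S` at which the permutation `π` attains its
minimum over `S` (the argmin of `π` on `S`). -/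
noncomputable def argminOn {m : ℕ} (π : Equiv.Perm (Fin m)) (S : Finset (Fin m))
    (hS : S.Nonempty) : Fin m :=
  π.symm ((S.image π).min' (hS.image π))

theorem argminOn_eq_iff {m : ℕ} (π : Equiv.Perm (Fin m)) (S : Finset (Fin m))
    (hS : S.Nonempty) (a : Fin m) :
    argminOn π S hS = a ↔ a ∈ S ∧ ∀ b ∈ S, π a ≤ π b := by
  rw [argminOn, Equiv.symm_apply_eq, Finset.min'_eq_iff]
  simp

theorem argminOn_mem {m : ℕ} (π : Equiv.Perm (Fin m)) (S : Finset (Fin m))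
    (hS : S.Nonempty) : argminOn π S hS ∈ S :=
  ((argminOn_eq_iff π S hS _).1 rfl).1

theorem argminOn_le {m : ℕ} (π : Equiv.Perm (Fin m)) (S : Finset (Fin m))
    (hS : S.Nonempty) {b : Fin m} (hb : b ∈ S) : π (argminOn π S hS) ≤ π b :=
  ((argminOn_eq_iff π S hS _).1 rfl).2 b hb

/-- The argmins over `S` and `T` coincide exactly when the argmin over `S ∪ T` lies in `S ∩ T`. -/
theorem argminOn_eq_argminOn_iff {m : ℕ} (π : Equiv.Perm (Fin m)) (S T : Finset (Fin m))
    (hS : S.Nonempty) (hT : T.Nonempty) :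
    argminOn π S hS = argminOn π T hT ↔ argminOn π (S ∪ T) (hS.mono Finset.subset_union_left) ∈
      S ∩ T := by
  constructor
  · intro h
    have hU : argminOn π (S ∪ T) (hS.mono Finset.subset_union_left) = argminOn π S hS := by
      refine (argminOn_eq_iff _ _ _ _).2
        ⟨Finset.mem_union_left _ (argminOn_mem π S hS), fun b hb => ?_⟩
      rcases Finset.mem_union.1 hb with hb | hb
      · exact argminOn_le π S hS hb
      · exact h ▸ argminOn_le π T hT hb
    rw [hU]
    exact Finset.mem_inter.2 ⟨argminOn_mem π S hS, h ▸ argminOn_mem π T hT⟩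
  · intro h
    obtain ⟨h₁, h₂⟩ := Finset.mem_inter.1 h
    rw [(argminOn_eq_iff π S hS _).2
        ⟨h₁, fun b hb => argminOn_le π _ _ (Finset.mem_union_left _ hb)⟩,
      (argminOn_eq_iff π T hT _).2
        ⟨h₂, fun b hb => argminOn_le π _ _ (Finset.mem_union_right _ hb)⟩]

theorem argminOn_mul_swap {m : ℕ} (π : Equiv.Perm (Fin m)) (S : Finset (Fin m))
    (hS : S.Nonempty) {a b : Fin m} (ha : a ∈ S) (hb : b ∈ S) (h : argminOn π S hS = a) :
    argminOn (π * Equiv.swap a b) S hS = b := by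
  refine (argminOn_eq_iff _ _ _ _).2 ⟨hb, fun c hc => ?_⟩
  rw [Equiv.Perm.mul_apply, Equiv.Perm.mul_apply, Equiv.swap_apply_right]
  refine ((argminOn_eq_iff _ _ _ _).1 h).2 _ ?_
  rw [Equiv.swap_apply_def]
  split_ifs <;> assumption

theorem card_filter_argminOn_le {m : ℕ} (S : Finset (Fin m)) (hS : S.Nonempty) {a b : Fin m}
    (ha : a ∈ S) (hb : b ∈ S) :
    (Finset.univ.filter fun π : Equiv.Perm (Fin m) => argminOn π S hS = a).card ≤
      (Finset.univ.filter fun π : Equiv.Perm (Fin m) => argminOn π S hS = b).card := by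
  refine Finset.card_le_card_of_injOn (fun π => π * Equiv.swap a b) (fun π h => ?_)
    (mul_left_injective _).injOn
  simp only [Finset.coe_filter, Finset.mem_univ, true_and, Set.mem_ofPred_eq] at h ⊢
  exact argminOn_mul_swap π S hS ha hb h

theorem card_filter_argminOn_mem {m : ℕ} (S A : Finset (Fin m)) (hS : S.Nonempty) :
    (Finset.univ.filter fun π : Equiv.Perm (Fin m) => argminOn π S hS ∈ A).card =
      ∑ a ∈ A, (Finset.univ.filter fun π : Equiv.Perm (Fin m) => argminOn π S hS = a).card := by
  rw [Finset.card_eq_sum_card_fiberwise (f := fun π => argminOn π S hS) (t := A)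
    (fun π h => by simpa using h)]
  refine Finset.sum_congr rfl fun a ha => ?_
  rw [Finset.filter_filter]
  congr 1
  ext π
  simp only [Finset.mem_filter, Finset.mem_univ, true_and, and_iff_right_iff_imp]
  rintro rfl
  exact ha

/-- The argmin over `S` of a uniformly random permutation is uniformly distributed on `S`. -/
theorem card_mul_card_filter_argminOn {m : ℕ} (S : Finset (Fin m)) (hS : S.Nonempty) {a : Fin m}
    (ha : a ∈ S) :
    S.card * (Finset.univ.filter fun π : Equiv.Perm (Fin m) => argminOn π S hS = a).card =
      m.factorial := by
  have h := card_filter_argminOn_mem S S hS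
  rw [Finset.filter_true_of_mem fun π _ => argminOn_mem π S hS, Finset.card_univ,
    Fintype.card_perm, Fintype.card_fin] at h
  rw [h, Finset.sum_congr rfl fun b hb => le_antisymm (card_filter_argminOn_le S hS hb ha)
    (card_filter_argminOn_le S hS ha hb), Finset.sum_const, smul_eq_mul]

theorem card_mul_card_filter_argminOn_mem {m : ℕ} (S A : Finset (Fin m)) (hS : S.Nonempty)
    (hA : A ⊆ S) :
    S.card * (Finset.univ.filter fun π : Equiv.Perm (Fin m) => argminOn π S hS ∈ A).card =
      m.factorial * A.card := by
  rw [card_filter_argminOn_mem, Finset.mul_sum,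
    Finset.sum_congr rfl fun a ha => card_mul_card_filter_argminOn S hS (hA ha),
    Finset.sum_const, smul_eq_mul, mul_comm]

/-- For a uniformly random permutation `π` of `{1,…,m}` and nonempty subsets
`S`, `T`, the probability that `argmin_{i∈S} π(i) = argmin_{i∈T} π(i)` equals
`|S∩T|/|S∪T|`; equivalently the number of such permutations is `m!·|S∩T|/|S∪T|`. -/
theorem argmin_coincidence_probability
    (m : ℕ) (S T : Finset (Fin m)) (hS : S.Nonempty) (hT : T.Nonempty) :
    (((Finset.univ.filter (fun π : Equiv.Perm (Fin m) =>
        argminOn π S hS = argminOn π T hT)).card : ℝ) / (Nat.factorial m : ℝ)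
      = ((S ∩ T).card : ℝ) / ((S ∪ T).card : ℝ)) ∧
    (((Finset.univ.filter (fun π : Equiv.Perm (Fin m) =>
        argminOn π S hS = argminOn π T hT)).card : ℝ)
      = (Nat.factorial m : ℝ) * ((S ∩ T).card : ℝ) / ((S ∪ T).card : ℝ)) := by
  have hU : (S ∪ T).Nonempty := hS.mono Finset.subset_union_left
  have hcard := card_mul_card_filter_argminOn_mem (S ∪ T) (S ∩ T) hU
    (Finset.inter_subset_left.trans Finset.subset_union_left)
  simp only [← argminOn_eq_argminOn_iff _ S T hS hT] at hcard
  have hcard' := congrArg (Nat.cast : ℕ → ℝ) hcard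
  push_cast at hcard'
  have hU₀ : ((S ∪ T).card : ℝ) ≠ 0 := Nat.cast_ne_zero.2 hU.card_pos.ne'
  have hm₀ : (m.factorial : ℝ) ≠ 0 := Nat.cast_ne_zero.2 m.factorial_ne_zero
  constructor
  · rw [div_eq_div_iff hm₀ hU₀]
    linarith
  · rw [eq_div_iff hU₀]
    linarith
end

section
/- For each job j ∈ {1,...,n}, let σ_j be a permutation of the machines {1,...,m}, let ρ be a permutation of {1,...,m} chosen uniformly at random, and consider the preference-based algorithm A that in state S assigns job j to the machine i ∈ S minimizing σ_j(ρ(i)). Then for all nonempty states S and T, the expected reassignment cost satisfies E[r_A(S,T)] ≤ 2·r*(S,T), where r*(S,T) = n·(1 − |S∩T|/max(|S|,|T|)). -/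
open Finset in
/-- The minimizer over `U` of an injective key precomposed with a permutation hits every point
of `U` for the same number of permutations. -/
theorem card_perm_argmin_eq {α β : Type*} [Fintype α] [DecidableEq α] [LinearOrder β]
    {key : α → β} (hkey : Function.Injective key) {U : Finset α} {g : Equiv.Perm α → α}
    (hg : ∀ ρ, g ρ ∈ U ∧ ∀ i ∈ U, key (ρ (g ρ)) ≤ key (ρ i)) {x y : α}
    (hx : x ∈ U) (hy : y ∈ U) :
    #{ρ | g ρ = x} = #{ρ | g ρ = y} := by
  have swap_mem : ∀ i ∈ U, Equiv.swap x y i ∈ U := by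
    intro i hi
    rw [Equiv.swap_apply_def]
    split_ifs <;> assumption
  have equivariant : ∀ ρ, g (ρ * Equiv.swap x y) = Equiv.swap x y (g ρ) := by
    intro ρ
    have h₁ := (hg (ρ * Equiv.swap x y)).2 _ (swap_mem _ (hg ρ).1)
    have h₂ := (hg ρ).2 _ (swap_mem _ (hg (ρ * Equiv.swap x y)).1)
    simp only [Equiv.Perm.mul_apply, Equiv.swap_apply_self] at h₁
    have h := ρ.injective (hkey (le_antisymm h₁ h₂))
    rw [← h, Equiv.swap_apply_self]
  refine card_equiv (Equiv.mulRight (Equiv.swap x y)) fun ρ => ?_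
  simp [equivariant, Equiv.swap_apply_eq_iff]

open Finset in
/-- The minimizer over `U` of an injective key precomposed with a uniformly random permutation
lies in `I ⊆ U` with probability `|I| / |U|`. -/
theorem card_mul_card_perm_argmin_mem {α β : Type*} [Fintype α] [DecidableEq α] [LinearOrder β]
    {key : α → β} (hkey : Function.Injective key) {U I : Finset α} {g : Equiv.Perm α → α}
    (hg : ∀ ρ, g ρ ∈ U ∧ ∀ i ∈ U, key (ρ (g ρ)) ≤ key (ρ i)) (hI : I ⊆ U) :
    #U * #{ρ | g ρ ∈ I} = #I * (Fintype.card α).factorial := by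
  have hU : g 1 ∈ U := (hg 1).1
  have key_count : ∀ J ⊆ U, #{ρ | g ρ ∈ J} = #J * #{ρ | g ρ = g 1} := by
    intro J hJ
    rw [card_eq_sum_card_fiberwise (f := g) (t := J) (by intro ρ; simp),
      ← smul_eq_mul, ← sum_const]
    refine sum_congr rfl fun x hx => ?_
    rw [← card_perm_argmin_eq hkey hg (hJ hx) hU, filter_filter]
    congr 1
    ext ρ
    simp only [mem_filter, mem_univ, true_and, and_iff_right_iff_imp]
    rintro rfl
    exact hx
  have total : #{ρ | g ρ ∈ U} = (Fintype.card α).factorial := by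
    rw [filter_true_of_mem fun ρ _ => (hg ρ).1, card_univ, Fintype.card_perm]
  rw [← total, key_count I hI, key_count U subset_rfl]
  ring

/-- If the minimizer over `S ∪ T` lies in `S ∩ T`, it is the minimizer over both `S` and `T`. -/
theorem argmin_eq_of_argmin_union_mem_inter {α β : Type*} [DecidableEq α] [LinearOrder β]
    {key : α → β} (hkey : Function.Injective key) {S T : Finset α} {s t u : α}
    (hs : s ∈ S ∧ ∀ i ∈ S, key s ≤ key i) (ht : t ∈ T ∧ ∀ i ∈ T, key t ≤ key i)
    (hu : ∀ i ∈ S ∪ T, key u ≤ key i) (hmem : u ∈ S ∩ T) : s = t := by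
  obtain ⟨huS, huT⟩ := Finset.mem_inter.1 hmem
  have h₁ := hkey (le_antisymm (hs.2 u huS) (hu s (Finset.mem_union_left _ hs.1)))
  have h₂ := hkey (le_antisymm (ht.2 u huT) (hu t (Finset.mem_union_right _ ht.1)))
  exact h₁.trans h₂.symm

/-- The Jaccard distance is at most twice the distance normalized by the larger set. -/
theorem one_sub_card_inter_div_card_union_le {α : Type*} [DecidableEq α] {S T : Finset α}
    (hS : S.Nonempty) :
    1 - ((S ∩ T).card : ℝ) / ((S ∪ T).card : ℝ)
      ≤ 2 * (1 - ((S ∩ T).card : ℝ) / ((max S.card T.card : ℕ) : ℝ)) := by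
  have hsum := Finset.card_union_add_card_inter S T
  have hS' := hS.card_pos
  have hSU := Finset.card_le_card (Finset.subset_union_left (s₁ := S) (s₂ := T))
  have hTU := Finset.card_le_card (Finset.subset_union_right (s₁ := S) (s₂ := T))
  have hIS := Finset.card_le_card (Finset.inter_subset_left (s₁ := S) (s₂ := T))
  generalize hM : max S.card T.card = M
  generalize (S ∩ T).card = c at *
  generalize (S ∪ T).card = u at *
  have hM0 : (0 : ℝ) < M := by exact_mod_cast (by omega : 0 < M)
  have hMu : (M : ℝ) ≤ u := by exact_mod_cast (by omega : M ≤ u)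
  have hcM : (c : ℝ) ≤ M := by exact_mod_cast (by omega : c ≤ M)
  have huM : (u : ℝ) + c ≤ 2 * M := by exact_mod_cast (by omega : u + c ≤ 2 * M)
  have hu0 : (0 : ℝ) < u := hM0.trans_le hMu
  calc 1 - (c : ℝ) / u = (u - c) / u := by field_simp
    _ ≤ (2 * (M - c)) / M := by gcongr; linarith
    _ = 2 * (1 - c / M) := by field_simp

/-- For any preference-based algorithm (each job `j` assigned, in state `S`,
to the machine `i ∈ S` minimizing `σ_j(ρ(i))`, with `ρ` a uniformly random permutation),
the expected reassignment cost between any states `S` and `T` is at most `2·r*(S,T)`,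
where `r*(S,T) = n·(1 − |S∩T|/max(|S|,|T|))`. -/
theorem preference_based_reassignment_vs_reference
    (n m : ℕ) (σ : Fin n → Equiv.Perm (Fin m))
    (A : Equiv.Perm (Fin m) → Finset (Fin m) → Fin n → Fin m)
    (hA : ∀ (ρ : Equiv.Perm (Fin m)) (S : Finset (Fin m)), S.Nonempty → ∀ j : Fin n,
      A ρ S j ∈ S ∧ ∀ i ∈ S, σ j (ρ (A ρ S j)) ≤ σ j (ρ i))
    (S T : Finset (Fin m)) (hS : S.Nonempty) (hT : T.Nonempty) :
    (1 / (Nat.factorial m : ℝ)) * ∑ ρ : Equiv.Perm (Fin m),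
        ((Finset.univ.filter (fun j : Fin n => A ρ S j ≠ A ρ T j)).card : ℝ)
      ≤ 2 * ((n : ℝ) * (1 - ((S ∩ T).card : ℝ) / ((max S.card T.card : ℕ) : ℝ))) := by
  have hU : (S ∪ T).Nonempty := hS.mono Finset.subset_union_left
  have hU0 : (0 : ℝ) < (S ∪ T).card := by exact_mod_cast hU.card_pos
  have hm : (0 : ℝ) < (Nat.factorial m : ℝ) := by exact_mod_cast m.factorial_pos
  have per_job : ∀ j : Fin n,
      ((Finset.univ.filter fun ρ : Equiv.Perm (Fin m) => A ρ S j ≠ A ρ T j).card : ℝ)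
        ≤ m.factorial * (1 - ((S ∩ T).card : ℝ) / ((S ∪ T).card : ℝ)) := by
    intro j
    have hsub : (Finset.univ.filter fun ρ : Equiv.Perm (Fin m) => A ρ S j ≠ A ρ T j) ⊆
        Finset.univ.filter fun ρ => ¬ A ρ (S ∪ T) j ∈ S ∩ T :=
      Finset.monotone_filter_right _ fun ρ _ hne hmem =>
        hne (argmin_eq_of_argmin_union_mem_inter (key := fun i => σ j (ρ i))
          ((σ j).injective.comp ρ.injective) (hA ρ S hS j) (hA ρ T hT j)
          (hA ρ _ hU j).2 hmem)
    have hle : ((Finset.univ.filter fun ρ : Equiv.Perm (Fin m) =>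
          A ρ S j ≠ A ρ T j).card : ℝ) ≤
        (Finset.univ.filter fun ρ => ¬ A ρ (S ∪ T) j ∈ S ∩ T).card := by
      exact_mod_cast Finset.card_le_card hsub
    have hsplit : ((Finset.univ.filter fun ρ => A ρ (S ∪ T) j ∈ S ∩ T).card : ℝ) +
        (Finset.univ.filter fun ρ => ¬ A ρ (S ∪ T) j ∈ S ∩ T).card = m.factorial := by
      have h := Finset.card_filter_add_card_filter_not (s := Finset.univ)
        fun ρ => A ρ (S ∪ T) j ∈ S ∩ T
      rw [Finset.card_univ, Fintype.card_perm, Fintype.card_fin] at h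
      exact_mod_cast h
    have hcount : ((S ∪ T).card : ℝ) *
        (Finset.univ.filter fun ρ => A ρ (S ∪ T) j ∈ S ∩ T).card =
        (S ∩ T).card * m.factorial := by
      have h := card_mul_card_perm_argmin_mem (σ j).injective (fun ρ => hA ρ _ hU j)
        (Finset.inter_subset_left.trans Finset.subset_union_left : S ∩ T ⊆ S ∪ T)
      rw [Fintype.card_fin] at h
      exact_mod_cast h
    have hprob : ((Finset.univ.filter fun ρ => A ρ (S ∪ T) j ∈ S ∩ T).card : ℝ) =
        m.factorial * ((S ∩ T).card / (S ∪ T).card) := by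
      field_simp
      linarith
    linarith
  have exchange : ∑ ρ : Equiv.Perm (Fin m),
        ((Finset.univ.filter (fun j : Fin n => A ρ S j ≠ A ρ T j)).card : ℝ) =
      ∑ j : Fin n,
        ((Finset.univ.filter fun ρ : Equiv.Perm (Fin m) => A ρ S j ≠ A ρ T j).card : ℝ) := by
    exact_mod_cast Finset.sum_card_bipartiteAbove_eq_sum_card_bipartiteBelow
      (s := Finset.univ) (t := Finset.univ) fun ρ j => A ρ S j ≠ A ρ T j
  calc _ ≤ (1 / (Nat.factorial m : ℝ)) * ∑ _j : Fin n,
        (m.factorial : ℝ) * (1 - ((S ∩ T).card : ℝ) / ((S ∪ T).card : ℝ)) := by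
        rw [exchange]
        gcongr with j
        exact per_job j
    _ = n * (1 - ((S ∩ T).card : ℝ) / ((S ∪ T).card : ℝ)) := by
        rw [Finset.sum_const, Finset.card_univ, Fintype.card_fin, nsmul_eq_mul]
        field_simp
    _ ≤ n * (2 * (1 - ((S ∩ T).card : ℝ) / ((max S.card T.card : ℕ) : ℝ))) := by
        gcongr
        exact one_sub_card_inter_div_card_union_le hS
    _ = _ := by ring
end

section
/- Let n balls with non-negative weights w_1, ..., w_n be distributed independently and uniformly at random into b bins, where 1 ≤ b ≤ m. Let W = max(max_i w_i, (1/b)·Σ_{i=1}^n w_i), and let X be the maximum over all bins of the total weight of the balls in that bin. Then for any fixed c > 0 there exists a constant k and a threshold m₀ such that for all m ≥ m₀ (and any such n, b ≤ m, and weights), Pr[X > k·W·(ln m)/(ln ln m)] ≤ m^{−c}. -/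
open Finset in
/-- The exponential moment of the load of bin `j`, summed over all placements. -/
lemma sum_exp_load {ι κ : Type*} [Fintype ι] [DecidableEq ι] [Fintype κ] [DecidableEq κ]
    (w : ι → ℝ) (t : ℝ) (j : κ) :
    ∑ f : ι → κ, Real.exp (t * ∑ i ∈ univ.filter (fun i => f i = j), w i) =
      ∏ i, ((Fintype.card κ : ℝ) - 1 + Real.exp (t * w i)) := by
  have hfactor : ∀ i, (Fintype.card κ : ℝ) - 1 + Real.exp (t * w i) =
      ∑ x : κ, if x = j then Real.exp (t * w i) else 1 := by
    intro i
    rw [← add_sum_erase _ _ (mem_univ j),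
      sum_congr rfl fun x hx => if_neg (ne_of_mem_erase hx)]
    simp [card_erase_of_mem, Nat.cast_pred (Fintype.card_pos_iff.mpr ⟨j⟩), add_comm]
  simp_rw [hfactor]
  rw [prod_univ_sum, Fintype.piFinset_univ]
  refine sum_congr rfl fun f _ => ?_
  rw [mul_sum, Real.exp_sum, prod_filter]

/-- The chord bound for the exponential function on `[0, W]`. -/
lemma exp_mul_le_chord {t x W : ℝ} (hW : 0 < W) (hx : 0 ≤ x) (hxW : x ≤ W) :
    Real.exp (t * x) ≤ 1 + x / W * (Real.exp (t * W) - 1) := by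
  have h := convexOn_exp.2 (Set.mem_univ 0) (Set.mem_univ (t * W))
    (sub_nonneg.mpr ((div_le_one hW).mpr hxW)) (div_nonneg hx hW.le) (sub_add_cancel 1 (x / W))
  have he : x / W * (t * W) = t * x := by field_simp
  simp only [smul_eq_mul, mul_zero, zero_add, Real.exp_zero, mul_one, he] at h
  linarith

lemma prod_exp_load_le {ι : Type*} [Fintype ι] {w : ι → ℝ} {b t W : ℝ} (hb : 1 ≤ b)
    (ht : 0 ≤ t) (hW : 0 < W) (hw : ∀ i, 0 ≤ w i) (hwW : ∀ i, w i ≤ W)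
    (hsum : (∑ i, w i) / b ≤ W) :
    ∏ i, (b - 1 + Real.exp (t * w i)) ≤
      b ^ Fintype.card ι * Real.exp (Real.exp (t * W) - 1) := by
  have hb0 : 0 < b := by linarith
  have hE : 0 ≤ Real.exp (t * W) - 1 := sub_nonneg.mpr (Real.one_le_exp (by positivity))
  calc ∏ i, (b - 1 + Real.exp (t * w i))
      ≤ ∏ i, b * Real.exp (w i / b * ((Real.exp (t * W) - 1) / W)) := by
        refine Finset.prod_le_prod (fun i _ => by have := Real.exp_pos (t * w i); linarith)
          fun i _ => ?_
        have h1 := exp_mul_le_chord (t := t) hW (hw i) (hwW i)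
        have h2 := mul_le_mul_of_nonneg_left
          (Real.add_one_le_exp (w i / b * ((Real.exp (t * W) - 1) / W))) hb0.le
        have h3 : b * (w i / b * ((Real.exp (t * W) - 1) / W) + 1) =
            w i / W * (Real.exp (t * W) - 1) + b := by field_simp
        linarith
    _ = b ^ Fintype.card ι *
          Real.exp ((∑ i, w i) / b * ((Real.exp (t * W) - 1) / W)) := by
        rw [Finset.prod_mul_distrib, ← Real.exp_sum, Finset.prod_const, Finset.card_univ,
          ← Finset.sum_mul, ← Finset.sum_div]
    _ ≤ b ^ Fintype.card ι * Real.exp (Real.exp (t * W) - 1) := by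
        gcongr
        calc (∑ i, w i) / b * ((Real.exp (t * W) - 1) / W)
            ≤ W * ((Real.exp (t * W) - 1) / W) := by gcongr
          _ = Real.exp (t * W) - 1 := by field_simp

open Finset in
/-- Markov's inequality for the exponential moment, with a union bound over the bins. -/
lemma card_exists_load_gt_mul_exp_le {ι κ : Type*} [Fintype ι] [DecidableEq ι] [Fintype κ]
    [DecidableEq κ] (w : ι → ℝ) {t : ℝ} (ht : 0 ≤ t) (T : ℝ) :
    (Nat.card {f : ι → κ // ∃ j, T < ∑ i ∈ univ.filter (fun i => f i = j), w i} : ℝ) *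
        Real.exp (t * T) ≤
      Fintype.card κ * ∏ i, ((Fintype.card κ : ℝ) - 1 + Real.exp (t * w i)) := by
  classical
  rw [Nat.card_eq_fintype_card, Fintype.card_subtype, ← nsmul_eq_mul, ← sum_const]
  calc _ ≤ ∑ f ∈ univ.filter (fun f : ι → κ =>
            ∃ j, T < ∑ i ∈ univ.filter (fun i => f i = j), w i),
          ∑ j, Real.exp (t * ∑ i ∈ univ.filter (fun i => f i = j), w i) := by
        refine sum_le_sum fun f hf => ?_
        obtain ⟨j, hj⟩ := (mem_filter.mp hf).2
        calc Real.exp (t * T)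
            ≤ Real.exp (t * ∑ i ∈ univ.filter (fun i => f i = j), w i) := by gcongr
          _ ≤ _ := single_le_sum
            (f := fun j => Real.exp (t * ∑ i ∈ univ.filter (fun i => f i = j), w i))
            (fun _ _ => (Real.exp_pos _).le) (mem_univ j)
    _ ≤ ∑ f : ι → κ, ∑ j, Real.exp (t * ∑ i ∈ univ.filter (fun i => f i = j), w i) :=
        sum_le_sum_of_subset_of_nonneg (filter_subset _ _)
          fun _ _ _ => sum_nonneg fun _ _ => (Real.exp_pos _).le
    _ = _ := by
        rw [sum_comm]
        simp [sum_exp_load]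


/-- weighted balls in bins: if `n` balls with non-negative weights
`w_1,…,w_n` are placed independently and uniformly at random into `b ≤ m` bins, and
`W = max(max_i w_i, (Σ w_i)/b)`, then for every `c > 0` there are a constant `k` and a
threshold `m₀` such that for all `m ≥ m₀` the probability that some bin receives total
weight more than `k·W·(ln m)/(ln ln m)` is at most `m^{−c}`. -/
theorem weighted_balls_in_bins
    (c : ℝ) (hc : 0 < c) :
    ∃ (k : ℝ) (m₀ : ℕ), ∀ m : ℕ, m₀ ≤ m →
      ∀ (n b : ℕ) (hn : 0 < n), 1 ≤ b → b ≤ m →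
      ∀ (w : Fin n → ℝ), (∀ i, 0 ≤ w i) →
      ∀ W : ℝ,
        W = max (Finset.univ.sup' (Finset.univ_nonempty_iff.mpr ⟨⟨0, hn⟩⟩) w)
              ((∑ i, w i) / (b : ℝ)) →
      (Nat.card {f : Fin n → Fin b // ∃ bin : Fin b,
          k * W * Real.log m / Real.log (Real.log m) <
            ∑ i ∈ Finset.univ.filter (fun i => f i = bin), w i} : ℝ) / ((b : ℝ) ^ n)
        ≤ (m : ℝ) ^ (-c) := by
  refine ⟨c + 2, 3, fun m hm n b hn hb hbm w hw W hW => ?_⟩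
  have hwW : ∀ i, w i ≤ W := fun i =>
    (Finset.le_sup' w (Finset.mem_univ i)).trans (hW ▸ le_max_left _ _)
  have hsum : (∑ i, w i) / (b : ℝ) ≤ W := hW ▸ le_max_right _ _
  have hm0 : (0 : ℝ) < m := by exact_mod_cast (by omega : 0 < m)
  have hb1 : (1 : ℝ) ≤ b := by exact_mod_cast hb
  have hlog : 1 < Real.log m := by
    rw [Real.lt_log_iff_exp_lt hm0]
    exact Real.exp_one_lt_three.trans_le (by exact_mod_cast hm)
  have hloglog : 0 < Real.log (Real.log m) := Real.log_pos hlog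
  rcases ((hw ⟨0, hn⟩).trans (hwW _)).eq_or_lt with rfl | hWpos
  · have hw0 : ∀ i, w i = 0 := fun i => le_antisymm (hwW i) (hw i)
    simp [hw0]
    positivity
  have ht : 0 ≤ Real.log (Real.log m) / W := by positivity
  have hcard := card_exists_load_gt_mul_exp_le (κ := Fin b) w ht
    ((c + 2) * W * Real.log m / Real.log (Real.log m))
  have hprod := prod_exp_load_le hb1 ht hWpos hw hwW hsum
  have hexp : Real.exp (Real.log (Real.log m) / W * W) = Real.log m := by
    rw [div_mul_cancel₀ _ hWpos.ne', Real.exp_log (by linarith)]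
  have hT : Real.log (Real.log m) / W * ((c + 2) * W * Real.log m / Real.log (Real.log m)) =
      Real.log m * (c + 2) := by field_simp
  rw [hT, ← Real.rpow_def_of_pos hm0, Fintype.card_fin] at hcard
  rw [hexp, Fintype.card_fin] at hprod
  have hle : Real.exp (Real.log m - 1) ≤ m := by
    calc _ ≤ Real.exp (Real.log m) := by gcongr; linarith
      _ = m := Real.exp_log hm0
  have hbm' : (b : ℝ) ≤ m := by exact_mod_cast hbm
  rw [div_le_iff₀ (by positivity)]
  refine le_of_mul_le_mul_right (hcard.trans ?_) (Real.rpow_pos_of_pos hm0 (c + 2))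
  calc (b : ℝ) * ∏ i, ((b : ℝ) - 1 + Real.exp (Real.log (Real.log m) / W * w i))
      ≤ m * ((b : ℝ) ^ n * m) := by
        gcongr
        exact hprod.trans (by gcongr)
    _ = (m : ℝ) ^ (-c) * (b : ℝ) ^ n * (m : ℝ) ^ (c + 2) := by
        rw [mul_right_comm, ← Real.rpow_add hm0, neg_add_cancel_left, Real.rpow_two]
        ring
end

section
/- Fix a nonempty set S of available machines among m machines and jobs with sizes p_1, ..., p_n ≥ 0. Assign each job independently and uniformly at random to a machine in S (the random-preference algorithm restricted to state S), and let OPT be the minimum possible makespan of any assignment of the n jobs to the machines of S. Then for any fixed c > 0 there exists a constant k and a threshold m₀ such that for all m ≥ m₀, the makespan of the random assignment exceeds k·OPT·(ln m)/(ln ln m) with probability at most m^{−c}. -/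
open Finset in
/-- Moment generating function bound for the load of one cell `i` when items of weight
`x j ∈ [0, 1]` and average total weight at most one per cell are thrown uniformly at random. -/
theorem sum_exp_load_le {ι α : Type*} [Fintype ι] [DecidableEq ι] [Fintype α] [DecidableEq α]
    (i : α) {x : ι → ℝ} (hx0 : ∀ j, 0 ≤ x j) (hx1 : ∀ j, x j ≤ 1)
    (hsum : ∑ j, x j ≤ Fintype.card α) {t : ℝ} (ht : 0 ≤ t) :
    ∑ f : ι → α, Real.exp (t * ∑ j with f j = i, x j) ≤
      (Fintype.card α : ℝ) ^ Fintype.card ι * Real.exp (Real.exp t - 1) := by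
  have hs : (0 : ℝ) < Fintype.card α := by exact_mod_cast Fintype.card_pos_iff.2 ⟨i⟩
  have hcell (j : ι) : ∑ a : α, Real.exp (if a = i then t * x j else 0) ≤
      Fintype.card α * Real.exp (x j * (Real.exp t - 1) / Fintype.card α) := by
    have hconv : Real.exp (t * x j) ≤ 1 + x j * (Real.exp t - 1) := by
      have h := convexOn_exp.2 (Set.mem_univ (0 : ℝ)) (Set.mem_univ t)
        (sub_nonneg.2 (hx1 j)) (hx0 j) (by ring)
      simp only [smul_eq_mul, mul_zero, zero_add, Real.exp_zero, mul_one] at h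
      rw [mul_comm t]
      linarith
    have hval : ∑ a : α, Real.exp (if a = i then t * x j else 0) =
        Fintype.card α + (Real.exp (t * x j) - 1) := by
      have h (a : α) : Real.exp (if a = i then t * x j else 0) =
          1 + if a = i then Real.exp (t * x j) - 1 else 0 := by
        split_ifs <;> simp
      simp [h, sum_add_distrib]
    calc _ ≤ (Fintype.card α : ℝ) * (x j * (Real.exp t - 1) / Fintype.card α + 1) := by
          rw [hval]; field_simp; linarith
      _ ≤ _ := by gcongr; exact Real.add_one_le_exp _
  calc ∑ f : ι → α, Real.exp (t * ∑ j with f j = i, x j)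
      = ∑ f : ι → α, ∏ j, Real.exp (if f j = i then t * x j else 0) := by
        simp only [← Real.exp_sum, mul_sum, sum_filter, mul_ite, mul_zero]
    _ = ∏ j, ∑ a : α, Real.exp (if a = i then t * x j else 0) := by
        rw [prod_univ_sum, Fintype.piFinset_univ]
    _ ≤ ∏ j, (Fintype.card α : ℝ) * Real.exp (x j * (Real.exp t - 1) / Fintype.card α) :=
        prod_le_prod (fun _ _ => by positivity) fun j _ => hcell j
    _ = (Fintype.card α : ℝ) ^ Fintype.card ι *
          Real.exp ((∑ j, x j) * (Real.exp t - 1) / Fintype.card α) := by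
        rw [prod_mul_distrib, ← Real.exp_sum, sum_mul, sum_div]
        simp
    _ ≤ _ := by
        gcongr
        rw [div_le_iff₀ hs, mul_comm]
        exact mul_le_mul_of_nonneg_left hsum (sub_nonneg.2 (Real.one_le_exp ht))

open Finset in
/-- Chernoff bound combined with a union bound over the cells, in counting form. -/
theorem card_exists_load_gt_le {ι α : Type*} [Fintype ι] [DecidableEq ι] [Fintype α]
    [DecidableEq α] {x : ι → ℝ} (hx0 : ∀ j, 0 ≤ x j) (hx1 : ∀ j, x j ≤ 1)
    (hsum : ∑ j, x j ≤ Fintype.card α) {t : ℝ} (ht : 0 ≤ t) (K : ℝ) :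
    (Nat.card {f : ι → α // ∃ i, K < ∑ j with f j = i, x j} : ℝ) ≤
      (Fintype.card α : ℝ) ^ Fintype.card ι *
        (Fintype.card α * Real.exp (Real.exp t - 1 - t * K)) := by
  classical
  rw [Nat.card_eq_fintype_card, Fintype.card_subtype, card_filter]
  push_cast
  calc ∑ f : ι → α, (if ∃ i, K < ∑ j with f j = i, x j then (1 : ℝ) else 0)
      ≤ ∑ f : ι → α, ∑ i : α, Real.exp (t * ∑ j with f j = i, x j) * Real.exp (-(t * K)) := by
        refine sum_le_sum fun f _ => ?_
        split_ifs with h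
        · obtain ⟨i, hi⟩ := h
          refine le_trans ?_ (single_le_sum (fun _ _ => by positivity) (mem_univ i))
          rw [← Real.exp_add, Real.one_le_exp_iff]
          nlinarith
        · positivity
    _ = ∑ i : α, (∑ f : ι → α, Real.exp (t * ∑ j with f j = i, x j)) * Real.exp (-(t * K)) := by
        rw [sum_comm]
        simp only [sum_mul]
    _ ≤ ∑ _i : α, (Fintype.card α : ℝ) ^ Fintype.card ι * Real.exp (Real.exp t - 1) *
          Real.exp (-(t * K)) := by
        gcongr with i
        exact sum_exp_load_le i hx0 hx1 hsum ht
    _ = _ := by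
        rw [sum_const, card_univ, nsmul_eq_mul, sub_eq_add_neg _ (t * K), Real.exp_add]
        ring


/-- Fix a nonempty set `S` of available machines among `m` machines and
jobs with non-negative sizes `p_1,…,p_n`. If each job is assigned independently and
uniformly at random to a machine of `S`, and `OPT` is the optimal makespan of assigning
the `n` jobs to the machines of `S`, then for every `c > 0` there are a constant `k` and
a threshold `m₀` such that for all `m ≥ m₀`, the probability that the makespan of the
random assignment exceeds `k·OPT·(ln m)/(ln ln m)` is at most `m^{−c}`. -/
theorem random_preference_makespan
    (c : ℝ) (hc : 0 < c) :
    ∃ (k : ℝ) (m₀ : ℕ), ∀ m : ℕ, m₀ ≤ m →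
      ∀ (n : ℕ) (S : Finset (Fin m)), S.Nonempty →
      ∀ (p : Fin n → ℝ), (∀ j, 0 ≤ p j) →
      ∀ OPT : ℝ,
        IsLeast {C : ℝ | ∃ g : Fin n → Fin m, (∀ j, g j ∈ S) ∧
          ∀ i : Fin m, ∑ j ∈ Finset.univ.filter (fun j => g j = i), p j ≤ C} OPT →
      (Nat.card {f : Fin n → {x // x ∈ S} // ∃ i : {x // x ∈ S},
          k * OPT * Real.log m / Real.log (Real.log m) <
            ∑ j ∈ Finset.univ.filter (fun j => f j = i), p j} : ℝ) / ((S.card : ℝ) ^ n)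
        ≤ (m : ℝ) ^ (-c) := by
  refine ⟨c + 2, 3, fun m hm n S hS p hp OPT hOPT => ?_⟩
  obtain ⟨⟨g, hgS, hg⟩, -⟩ := hOPT
  have hpOPT (j : Fin n) : p j ≤ OPT :=
    (Finset.single_le_sum (f := p) (s := Finset.univ.filter fun l => g l = g j)
      (fun l _ => hp l) (by simp)).trans (hg (g j))
  have hsum : ∑ j, p j ≤ S.card * OPT := by
    rw [← Finset.sum_fiberwise_of_maps_to (fun j _ => hgS j), ← nsmul_eq_mul]
    exact Finset.sum_le_card_nsmul _ _ _ fun i _ => hg i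
  have hm0 : (0 : ℝ) < m := by exact_mod_cast (by lia : 0 < m)
  have hL : 1 < Real.log m := by
    rw [Real.lt_log_iff_exp_lt hm0]
    exact (Real.exp_one_lt_d9.trans (by norm_num)).trans_le (by exact_mod_cast hm : (3 : ℝ) ≤ m)
  have hLL : 0 < Real.log (Real.log m) := Real.log_pos hL
  have hs0 : (0 : ℝ) < S.card := by exact_mod_cast hS.card_pos
  have hsm : (S.card : ℝ) ≤ m := by exact_mod_cast card_finset_fin_le S
  have hOPT0 : 0 ≤ OPT :=
    (Finset.sum_nonneg fun j _ => hp j).trans (hg hS.choose)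
  rcases hOPT0.eq_or_lt with rfl | hpos
  · have hp0 (j : Fin n) : p j = 0 := le_antisymm (hpOPT j) (hp j)
    simp only [hp0, Finset.sum_const_zero, mul_zero, zero_mul, zero_div, lt_irrefl, exists_false]
    simp only [Nat.card_of_isEmpty, Nat.cast_zero, zero_div]
    positivity
  have hscale (f : Fin n → {x // x ∈ S}) (i : {x // x ∈ S}) :
      (c + 2) * OPT * Real.log m / Real.log (Real.log m) <
          ∑ j ∈ Finset.univ.filter (fun j => f j = i), p j ↔
        (c + 2) * Real.log m / Real.log (Real.log m) <
          ∑ j ∈ Finset.univ.filter (fun j => f j = i), p j / OPT := by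
    rw [← Finset.sum_div, lt_div_iff₀ hpos]
    ring_nf
  simp only [hscale]
  have key := card_exists_load_gt_le (α := {x // x ∈ S}) (x := fun j => p j / OPT)
    (fun j => div_nonneg (hp j) hpos.le) (fun j => (div_le_one hpos).2 (hpOPT j))
    (by rw [← Finset.sum_div, div_le_iff₀ hpos]; simpa using hsum) hLL.le
    ((c + 2) * Real.log m / Real.log (Real.log m))
  rw [Fintype.card_coe, Fintype.card_fin, Real.exp_log (by linarith),
    mul_div_cancel₀ _ hLL.ne'] at key
  rw [div_le_iff₀' (by positivity)]
  refine key.trans (mul_le_mul_of_nonneg_left ?_ (by positivity))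
  calc (S.card : ℝ) * Real.exp (Real.log m - 1 - (c + 2) * Real.log m)
      ≤ Real.exp (Real.log m) * Real.exp (Real.log m - 1 - (c + 2) * Real.log m) := by
        rw [Real.exp_log hm0]; gcongr
    _ ≤ (m : ℝ) ^ (-c) := by
        rw [← Real.exp_add, Real.rpow_def_of_pos hm0, Real.exp_le_exp]
        linarith
end

section
/- Let p_0 ≥ p_1 ≥ ... ≥ p_{n−1} ≥ 0 be non-increasing non-negative reals, let d ≥ 1 be an integer, and let i ≥ 0. Then the sum of p over the arithmetic progression with common difference d starting at i satisfies Σ_{k ≥ 0, i+k·d ≤ n−1} p_{i+k·d} ≤ p_0 + (1/d)·Σ_{j=0}^{n−1} p_j. -/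
/-- A strengthening of the progression bound suited to induction on `n`: here `c` counts the terms
read since the last term of the progression, each of which is at least `x`. -/
theorem mul_sum_filter_modEq_add_le (p : ℕ → ℝ) (d r n : ℕ)
    (hmono : ∀ j k : ℕ, j ≤ k → k < n → p k ≤ p j) (c : ℕ) (hc : c < d)
    (hcn : n ≡ r + 1 + c [MOD d]) (x : ℝ) (hx : 0 ≤ x) (hx0 : x ≤ p 0)
    (hxp : ∀ j < n, x ≤ p j) :
    d * ∑ j ∈ (Finset.range n).filter (fun j => j ≡ r [MOD d]), p j + c * x
      ≤ d * p 0 + ∑ j ∈ Finset.range n, p j := by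
  induction n generalizing c x with
  | zero =>
    have hcd : (c : ℝ) ≤ d := by exact_mod_cast hc.le
    simpa using mul_le_mul hcd hx0 hx (Nat.cast_nonneg d)
  | succ n ih =>
    have hmono' : ∀ j k : ℕ, j ≤ k → k < n → p k ≤ p j :=
      fun j k hjk hk => hmono j k hjk (hk.trans n.lt_succ_self)
    have hxn : x ≤ p n := hxp n n.lt_succ_self
    rw [Finset.range_add_one, Finset.filter_insert, Finset.sum_insert (by simp)]
    cases c with
    | zero =>
      have hnr : n ≡ r [MOD d] := Nat.ModEq.add_right_cancel' 1 hcn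
      have hlast : n ≡ r + 1 + (d - 1) [MOD d] := by
        rw [show r + 1 + (d - 1) = r + d by omega]
        simpa [Nat.ModEq] using hnr
      have h := ih hmono' (d - 1) (by omega) hlast (p n) (hx.trans hxn)
        (hmono 0 n (Nat.zero_le n) n.lt_succ_self)
        (fun j hj => hmono j n hj.le n.lt_succ_self)
      rw [Nat.cast_sub (by omega : 1 ≤ d)] at h
      rw [if_pos hnr, Finset.sum_insert (by simp)]
      push_cast at h ⊢
      linarith
    | succ c =>
      have hcn' : n ≡ r + 1 + c [MOD d] := Nat.ModEq.add_right_cancel' 1 hcn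
      have hnr : ¬ n ≡ r [MOD d] := by
        intro hnr
        have h0 : r + (1 + c) ≡ r + 0 [MOD d] := by
          simpa [add_assoc] using hcn'.symm.trans hnr
        have h1 := Nat.ModEq.add_left_cancel' r h0
        rw [Nat.ModEq, Nat.mod_eq_of_lt (by omega), Nat.zero_mod] at h1
        omega
      have h := ih hmono' c (by omega) hcn' x hx hx0
        (fun j hj => hxp j (hj.trans n.lt_succ_self))
      rw [if_neg hnr]
      push_cast
      linarith

/-- For non-increasing non-negative reals `p_0 ≥ p_1 ≥ … ≥ p_{n−1} ≥ 0`,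
an integer `d ≥ 1`, and `i ≥ 0`, the sum of `p` over the arithmetic progression with
common difference `d` starting at `i` (within `{0,…,n−1}`) satisfies
`Σ_{k≥0, i+k·d ≤ n−1} p_{i+k·d} ≤ p_0 + (1/d)·Σ_{j=0}^{n−1} p_j`. -/
theorem arithmetic_progression_sum_bound
    (n : ℕ) (hn : 0 < n) (p : ℕ → ℝ)
    (hnn : ∀ j < n, 0 ≤ p j)
    (hmono : ∀ j k : ℕ, j ≤ k → k < n → p k ≤ p j)
    (d : ℕ) (hd : 1 ≤ d) (i : ℕ) :
    ∑ j ∈ (Finset.range n).filter (fun j => i ≤ j ∧ j % d = i % d), p j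
      ≤ p 0 + (1 / (d : ℝ)) * ∑ j ∈ Finset.range n, p j := by
  have hd0 : (0 : ℝ) < d := by exact_mod_cast hd
  have hr : i % d < d := Nat.mod_lt i hd
  have hc : n ≡ i % d + 1 + (n + (d - 1 - i % d)) % d [MOD d] := by
    have h := (Nat.mod_modEq (n + (d - 1 - i % d)) d).add_left (i % d + 1)
    rw [show i % d + 1 + (n + (d - 1 - i % d)) = n + d by omega] at h
    exact (h.trans (by simp [Nat.ModEq])).symm
  have h := mul_sum_filter_modEq_add_le p d (i % d) n hmono _ (Nat.mod_lt _ hd) hc 0 le_rfl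
    (hnn 0 hn) hnn
  have hsub : ∑ j ∈ (Finset.range n).filter (fun j => i ≤ j ∧ j % d = i % d), p j
      ≤ ∑ j ∈ (Finset.range n).filter (fun j => j ≡ i % d [MOD d]), p j := by
    refine Finset.sum_le_sum_of_subset_of_nonneg (fun j hj => ?_) (fun j hj _ => ?_)
    · simp only [Finset.mem_filter] at hj ⊢
      exact ⟨hj.1, by simpa [Nat.ModEq] using hj.2.2⟩
    · exact hnn j (Finset.mem_range.mp (Finset.mem_filter.mp hj).1)
  refine hsub.trans (le_of_mul_le_mul_left ?_ hd0)
  rw [mul_add, ← mul_assoc, mul_one_div_cancel hd0.ne', one_mul]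
  simpa using h
end

section
/- For any n ≥ 0 and any b ≥ 1, the bins produced by the binning function for b and for b+1 bins are related as follows: B^{(b)}_{b − 2^{⌊log₂ b⌋}} = B^{(b+1)}_{b − 2^{⌊log₂ b⌋}} ∪ B^{(b+1)}_b, and B^{(b)}_i = B^{(b+1)}_i for every i with 0 ≤ i ≤ b−1 and i ≠ b − 2^{⌊log₂ b⌋}. In particular, decreasing the number of bins from b+1 to b merges exactly one bin into another and leaves all other bins unchanged. -/
/-- `binA n i` is the set `A_i = {j : 0 ≤ j ≤ n−1, j ≡ i (mod 2^{⌈log₂(i+1)⌉})}`. -/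
def binA (n i : ℕ) : Finset ℕ :=
  (Finset.range n).filter (fun j => j % 2 ^ Nat.clog 2 (i + 1) = i)

/-- `binB n b i` is the bin `B^{(b)}_i = A_i ∖ ⋃_{l=i+1}^{b−1} B^{(b)}_l` of the
binning function for `n` jobs and `b` bins. -/
def binB (n b : ℕ) (i : ℕ) : Finset ℕ :=
  binA n i \ (Finset.Ico (i + 1) b).attach.biUnion (fun l => binB n b l.1)
termination_by b - i
decreasing_by
  obtain ⟨h1, h2⟩ := Finset.mem_Ico.mp l.2
  omega

theorem mem_binA {n i j : ℕ} :
    j ∈ binA n i ↔ j < n ∧ j % 2 ^ Nat.clog 2 (i + 1) = i := by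
  simp [binA]

/-- The bin `B^{(b)}_i` consists of the jobs in `A_i` that lie in no later `A_l`. -/
theorem mem_binB {n b j : ℕ} (i : ℕ) :
    j ∈ binB n b i ↔ j ∈ binA n i ∧ ∀ l, i < l → l < b → j ∉ binA n l := by
  have not_mem_binB_of_later : (∀ l, i < l → l < b → j ∉ binB n b l) ↔
      ∀ l, i < l → l < b → j ∉ binA n l := by
    refine ⟨fun h => ?_, fun h l hil hlb hj => ?_⟩
    · by_contra! hex
      obtain ⟨l, hil, hlb, hl⟩ := hex
      let P : ℕ → Prop := fun l => i < l ∧ l < b ∧ j ∈ binA n l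
      have hP : P l := ⟨hil, hlb, hl⟩
      classical
      obtain ⟨h₁, h₂, h₃⟩ : P (Nat.findGreatest P b) := Nat.findGreatest_spec hlb.le hP
      refine h _ h₁ h₂ ?_
      rw [binB]
      simp only [Finset.mem_sdiff, Finset.mem_biUnion, Finset.mem_attach, true_and,
        Subtype.exists, Finset.mem_Ico, not_exists]
      refine ⟨h₃, fun m hm hjm => ?_⟩
      rw [binB] at hjm
      exact Nat.findGreatest_is_greatest hm.1 hm.2.le
        ⟨by omega, hm.2, (Finset.mem_sdiff.mp hjm).1⟩
    · rw [binB] at hj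
      exact h l hil hlb (Finset.mem_sdiff.mp hj).1
  rw [← not_mem_binB_of_later, binB]
  simp only [Finset.mem_sdiff, Finset.mem_biUnion, Finset.mem_attach, true_and,
    Subtype.exists, Finset.mem_Ico, not_exists]
  exact and_congr_right fun _ => ⟨fun h l h₁ h₂ => h l ⟨h₁, h₂⟩, fun h l hl => h l hl.1 hl.2⟩

theorem mem_binB_succ {n b i j : ℕ} (hi : i < b) :
    j ∈ binB n (b + 1) i ↔ j ∈ binB n b i ∧ j ∉ binA n b := by
  rw [mem_binB, mem_binB, and_assoc]
  refine and_congr_right fun _ => ⟨fun h => ⟨fun l h₁ h₂ => h l h₁ (by omega),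
    h b hi (by omega)⟩, fun h l h₁ h₂ => ?_⟩
  rcases Nat.lt_succ_iff_lt_or_eq.mp h₂ with hl | rfl
  · exact h.1 l h₁ hl
  · exact h.2

theorem binB_succ_self (n b : ℕ) : binB n (b + 1) b = binA n b := by
  ext j
  rw [mem_binB]
  exact and_iff_left fun l h₁ h₂ => by omega

theorem clog_succ_eq_log_succ {b : ℕ} (hb : 1 ≤ b) :
    Nat.clog 2 (b + 1) = Nat.log 2 b + 1 := by
  apply le_antisymm
  · exact Nat.clog_le_of_le_pow (Nat.lt_pow_succ_log_self one_lt_two b)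
  · exact (Nat.lt_clog_iff_pow_lt one_lt_two).mpr
      (Nat.lt_succ_of_le (Nat.pow_log_le_self 2 (by omega)))

theorem mod_two_pow_log_of_mem_binA {n b j : ℕ} (hb : 1 ≤ b) (hj : j ∈ binA n b) :
    j % 2 ^ Nat.log 2 b = b - 2 ^ Nat.log 2 b := by
  have hmod := (mem_binA.mp hj).2
  rw [clog_succ_eq_log_succ hb] at hmod
  have hle : 2 ^ Nat.log 2 b ≤ b := Nat.pow_log_le_self 2 (by omega)
  have hlt : b < 2 ^ (Nat.log 2 b + 1) := Nat.lt_pow_succ_log_self one_lt_two b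
  rw [← Nat.mod_mod_of_dvd j (pow_dvd_pow 2 (Nat.le_succ (Nat.log 2 b))), hmod,
    Nat.mod_eq_sub_mod hle, Nat.mod_eq_of_lt]
  rw [pow_succ] at hlt
  omega

/-- Among the classes `A_l` with `l < b`, those meeting `A_b` have `l ≤ b − 2^{⌊log₂ b⌋}`. -/
theorem le_of_mem_binA_of_mem_binA {n b l j : ℕ} (hb : 1 ≤ b) (hlb : l < b)
    (hj : j ∈ binA n b) (hl : j ∈ binA n l) : l ≤ b - 2 ^ Nat.log 2 b := by
  rcases lt_or_ge l (2 ^ Nat.log 2 b) with h | h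
  · have hdvd : 2 ^ Nat.clog 2 (l + 1) ∣ 2 ^ Nat.log 2 b :=
      pow_dvd_pow 2 (Nat.clog_le_of_le_pow h)
    rw [← mod_two_pow_log_of_mem_binA hb hj]
    conv_lhs => rw [← (mem_binA.mp hl).2, ← Nat.mod_mod_of_dvd j hdvd]
    exact Nat.mod_le _ _
  · have hpos : 0 < 2 ^ Nat.log 2 b := by positivity
    have hlog : Nat.log 2 l = Nat.log 2 b :=
      le_antisymm (Nat.log_mono_right hlb.le) (Nat.le_log_of_pow_le one_lt_two h)
    have hl' := (mem_binA.mp hl).2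
    have hb' := (mem_binA.mp hj).2
    rw [clog_succ_eq_log_succ (by omega), hlog] at hl'
    rw [clog_succ_eq_log_succ hb] at hb'
    omega

theorem binA_subset_binB {n b : ℕ} (hb : 1 ≤ b) :
    binA n b ⊆ binB n b (b - 2 ^ Nat.log 2 b) := by
  intro j hj
  rw [mem_binB, mem_binA]
  refine ⟨⟨(mem_binA.mp hj).1, ?_⟩, fun l h₁ h₂ hl =>
    (le_of_mem_binA_of_mem_binA hb h₂ hj hl).not_gt h₁⟩
  have hlt : b - 2 ^ Nat.log 2 b + 1 ≤ 2 ^ Nat.log 2 b := by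
    rw [← mod_two_pow_log_of_mem_binA hb hj]
    exact Nat.mod_lt _ (by positivity)
  rw [← Nat.mod_mod_of_dvd j (pow_dvd_pow 2 (Nat.clog_le_of_le_pow hlt)),
    mod_two_pow_log_of_mem_binA hb hj]
  exact Nat.mod_eq_of_lt (Nat.le_pow_clog one_lt_two _)

theorem eq_of_mem_binB_of_mem_binB {n b i k j : ℕ} (hi : i < b) (hk : k < b)
    (hji : j ∈ binB n b i) (hjk : j ∈ binB n b k) : i = k := by
  rw [mem_binB] at hji hjk
  rcases lt_trichotomy i k with h | h | h
  · exact absurd hjk.1 (hji.2 k h hk)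
  · exact h
  · exact absurd hji.1 (hjk.2 i h hi)

/-- Decreasing the number of bins from `b+1` to `b` merges exactly one bin
into another and leaves all other bins unchanged:
`B^{(b)}_{b−2^{⌊log₂ b⌋}} = B^{(b+1)}_{b−2^{⌊log₂ b⌋}} ∪ B^{(b+1)}_b`, and
`B^{(b)}_i = B^{(b+1)}_i` for every other `i` with `0 ≤ i ≤ b−1`. -/
theorem bin_merge
    (n b : ℕ) (hb : 1 ≤ b) :
    binB n b (b - 2 ^ Nat.log 2 b)
        = binB n (b + 1) (b - 2 ^ Nat.log 2 b) ∪ binB n (b + 1) b ∧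
    ∀ i < b, i ≠ b - 2 ^ Nat.log 2 b → binB n b i = binB n (b + 1) i := by
  have hlt : b - 2 ^ Nat.log 2 b < b := Nat.sub_lt hb (by positivity)
  refine ⟨?_, fun i hi hne => ?_⟩
  · ext j
    rw [Finset.mem_union, mem_binB_succ hlt, binB_succ_self]
    have hsub := @binA_subset_binB n b hb j
    tauto
  · ext j
    rw [mem_binB_succ hi]
    exact ⟨fun h => ⟨h, fun hj =>
      hne (eq_of_mem_binB_of_mem_binB hi hlt h (binA_subset_binB hb hj))⟩, And.left⟩
end

section
/- Let n and m be integers with 0 ≤ n < m, and let Δ : {0, 1, ..., n} → ℝ be a function satisfying Δ(n) = 1 and, for each i with 0 ≤ i < n, either Δ(i) = 1 or Δ(i) ≤ 1 + ((n−i)/(m−i))·Δ(i') for some i' with i < i' ≤ n. Then Δ(i) ≤ 1/(1 − n/m) = m/(m−n) for all i with 0 ≤ i ≤ n. -/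
/-- The sharper bound `Δ i ≤ (m - i) / (m - n)`, by strong induction on `n - i`. -/
theorem displacement_le_sub_div_sub (n m : ℕ) (hnm : n < m) (Δ : ℕ → ℝ) (hΔn : Δ n = 1)
    (hΔ : ∀ i < n, Δ i = 1 ∨ ∃ i', i < i' ∧ i' ≤ n ∧
      Δ i ≤ 1 + (((n : ℝ) - i) / ((m : ℝ) - i)) * Δ i') (i : ℕ) (hi : i ≤ n) :
    Δ i ≤ ((m : ℝ) - i) / ((m : ℝ) - n) := by
  induction hk : n - i using Nat.strong_induction_on generalizing i with
  | _ k ih =>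
    have hmn : (0 : ℝ) < (m : ℝ) - n := sub_pos.mpr (Nat.cast_lt.mpr hnm)
    have hin : (i : ℝ) ≤ n := Nat.cast_le.mpr hi
    have hmi : (0 : ℝ) < (m : ℝ) - i := by linarith
    have hone : (1 : ℝ) ≤ ((m : ℝ) - i) / ((m : ℝ) - n) := by
      rw [le_div_iff₀ hmn]
      linarith
    rcases hi.eq_or_lt with rfl | hlt
    · rwa [hΔn]
    · rcases hΔ i hlt with h | ⟨j, hij, hjn, h⟩
      · rwa [h]
      · have hj : Δ j ≤ ((m : ℝ) - i) / ((m : ℝ) - n) := by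
          refine (ih (n - j) (by omega) j hjn rfl).trans ?_
          gcongr
        have hc : (0 : ℝ) ≤ ((n : ℝ) - i) / ((m : ℝ) - i) :=
          div_nonneg (sub_nonneg.mpr hin) hmi.le
        calc Δ i ≤ 1 + ((n : ℝ) - i) / ((m : ℝ) - i) * Δ j := h
          _ ≤ 1 + ((n : ℝ) - i) / ((m : ℝ) - i) * (((m : ℝ) - i) / ((m : ℝ) - n)) := by gcongr
          _ = ((m : ℝ) - i) / ((m : ℝ) - n) := by
            field_simp
            ring


/-- If `0 ≤ n < m` and `Δ : {0,…,n} → ℝ` satisfies `Δ(n) = 1` and, for each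
`i < n`, either `Δ(i) = 1` or `Δ(i) ≤ 1 + ((n−i)/(m−i))·Δ(i')` for some `i < i' ≤ n`,
then `Δ(i) ≤ 1/(1 − n/m) = m/(m−n)` for all `i ≤ n`. -/
theorem displacement_bound
    (n m : ℕ) (hnm : n < m) (Δ : ℕ → ℝ)
    (hΔn : Δ n = 1)
    (hΔ : ∀ i < n, Δ i = 1 ∨ ∃ i', i < i' ∧ i' ≤ n ∧
      Δ i ≤ 1 + (((n : ℝ) - i) / ((m : ℝ) - i)) * Δ i') :
    ∀ i ≤ n, Δ i ≤ 1 / (1 - (n : ℝ) / (m : ℝ)) ∧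
      1 / (1 - (n : ℝ) / (m : ℝ)) = (m : ℝ) / ((m : ℝ) - n) := by
  intro i hi
  have hmn : (0 : ℝ) < (m : ℝ) - n := sub_pos.mpr (Nat.cast_lt.mpr hnm)
  have hm : (0 : ℝ) < m := Nat.cast_pos.mpr (by omega)
  have heq : 1 / (1 - (n : ℝ) / (m : ℝ)) = (m : ℝ) / ((m : ℝ) - n) := by
    rw [one_sub_div hm.ne', one_div_div]
  refine ⟨?_, heq⟩
  rw [heq]
  refine (displacement_le_sub_div_sub n m hnm Δ hΔn hΔ i hi).trans ?_
  gcongr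
  exact sub_le_self _ i.cast_nonneg
end

section
/- Let n jobs have sizes p_0 ≥ p_1 ≥ ... ≥ p_{n−1} ≥ 0, let S be a nonempty set of available machines, let 0 < α < 1, and let b = max(⌊α|S|⌋, 1). Let B^{(b)}_0, ..., B^{(b)}_{b−1} be the bins produced by the binning function, and let OPT be the minimum possible makespan of any assignment of the n jobs to the machines of S. Then for every injective map h from the bins {0,...,b−1} into S (i.e., any assignment placing at most one bin on each machine), the resulting assignment of jobs to machines—job j goes to machine h(i) where i is the bin containing j—has makespan at most (1 + 2/α)·OPT. -/
theorem mem_binB_iff {n b i j : ℕ} :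
    j ∈ binB n b i ↔ j ∈ binA n i ∧ ∀ l, i < l → l < b → j ∉ binB n b l := by
  rw [binB]
  simp only [Finset.mem_sdiff, Finset.mem_biUnion, Finset.mem_attach, true_and, Subtype.exists,
    Finset.mem_Ico, not_exists]
  exact and_congr_right fun _ =>
    ⟨fun H l h1 h2 => H l ⟨h1, h2⟩, fun H l hl => H l hl.1 hl.2⟩

theorem exists_mem_binB_of_mem_binA {n b r j : ℕ} (hr : r < b) (hj : j ∈ binA n r) :
    ∃ l, r ≤ l ∧ l < b ∧ j ∈ binB n b l := by
  by_cases hB : j ∈ binB n b r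
  · exact ⟨r, le_rfl, hr, hB⟩
  · rw [mem_binB_iff] at hB
    push Not at hB
    obtain ⟨l, h1, h2, h3⟩ := hB hj
    exact ⟨l, h1.le, h2, h3⟩

theorem exists_mem_binB {n b j : ℕ} (hb : 0 < b) (hj : j < n) :
    ∃ l, l < b ∧ j ∈ binB n b l := by
  obtain ⟨l, -, hl⟩ := exists_mem_binB_of_mem_binA (n := n) (j := j) hb
    (by simp [binA, hj, Nat.mod_one])
  exact ⟨l, hl⟩

/-- All jobs of bin `i` are congruent to `i` modulo the largest power of two that is at most `b`. -/
theorem modEq_of_mem_binB {n b i j : ℕ} (hb : 0 < b) (hj : j ∈ binB n b i) :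
    j ≡ i [MOD 2 ^ Nat.log 2 b] := by
  obtain ⟨hA, hmax⟩ := mem_binB_iff.1 hj
  obtain ⟨hjn, hji⟩ : j < n ∧ j % 2 ^ Nat.clog 2 (i + 1) = i := by simpa [binA] using hA
  have hM : 2 ^ Nat.log 2 b ≤ b := Nat.pow_log_le_self 2 hb.ne'
  rcases le_total (Nat.log 2 b) (Nat.clog 2 (i + 1)) with hle | hle
  · have h := (Nat.mod_modEq j (2 ^ Nat.clog 2 (i + 1))).symm
    rw [hji] at h
    exact h.of_dvd (pow_dvd_pow 2 hle)
  · have hr : j % 2 ^ Nat.log 2 b < 2 ^ Nat.log 2 b := Nat.mod_lt _ (by positivity)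
    have hri : j % 2 ^ Nat.log 2 b ≤ i := by
      by_contra! hlt
      have hc : Nat.clog 2 (j % 2 ^ Nat.log 2 b + 1) ≤ Nat.log 2 b :=
        Nat.clog_le_of_le_pow hr
      have hmem : j ∈ binA n (j % 2 ^ Nat.log 2 b) := by
        simp only [binA, Finset.mem_filter, Finset.mem_range]
        refine ⟨hjn, ?_⟩
        rw [← Nat.mod_mod_of_dvd j (pow_dvd_pow 2 hc)]
        exact Nat.mod_eq_of_lt (Nat.lt_of_succ_le (Nat.le_pow_clog one_lt_two _))
      obtain ⟨l, h1, h2, h3⟩ := exists_mem_binB_of_mem_binA (hr.trans_le hM) hmem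
      exact hmax l (hlt.trans_le h1) h2 h3
    have hir : i ≤ j % 2 ^ Nat.log 2 b := by
      rw [← Nat.mod_mod_of_dvd j (pow_dvd_pow 2 hle)] at hji
      exact hji ▸ Nat.mod_le _ _
    have h := (Nat.mod_modEq j (2 ^ Nat.log 2 b)).symm
    rwa [le_antisymm hri hir] at h

/-- If the members of `T ⊆ {0, …, n-1}` are pairwise congruent modulo `M`, then charging each
member that is at least `M` to the `M` indices ending at it uses each index at most once. -/
theorem mul_sum_filter_le_sum_range {n M : ℕ} {p : ℕ → ℝ} (hnn : ∀ j < n, 0 ≤ p j)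
    (hmono : ∀ j k : ℕ, j ≤ k → k < n → p k ≤ p j) {T : Finset ℕ}
    (hT : ∀ j ∈ T, j < n) (hmod : ∀ j ∈ T, ∀ k ∈ T, j ≡ k [MOD M]) :
    M * ∑ j ∈ T with M ≤ j, p j ≤ ∑ j ∈ Finset.range n, p j := by
  have hdisj : Set.PairwiseDisjoint (T.filter (M ≤ ·) : Set ℕ)
      (fun j => Finset.Ioc (j - M) j) := by
    intro j hj k hk hjk
    rw [Finset.mem_coe, Finset.mem_filter] at hj hk
    rw [Function.onFun, Finset.disjoint_left]
    intro x hx hx'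
    rw [Finset.mem_Ioc] at hx hx'
    have h1 := hmod j hj.1 k hk.1
    rcases lt_or_gt_of_ne hjk with hlt | hlt
    · have := Nat.le_of_dvd (by omega) ((Nat.modEq_iff_dvd' hlt.le).1 h1)
      omega
    · have := Nat.le_of_dvd (by omega) ((Nat.modEq_iff_dvd' hlt.le).1 h1.symm)
      omega
  calc M * ∑ j ∈ T with M ≤ j, p j
      = ∑ j ∈ T with M ≤ j, ∑ _k ∈ Finset.Ioc (j - M) j, p j := by
        rw [Finset.mul_sum]
        refine Finset.sum_congr rfl fun j hj => ?_
        rw [Finset.sum_const, Nat.card_Ioc, nsmul_eq_mul,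
          Nat.sub_sub_self (Finset.mem_filter.1 hj).2]
    _ ≤ ∑ j ∈ T with M ≤ j, ∑ k ∈ Finset.Ioc (j - M) j, p k :=
        Finset.sum_le_sum fun j hj => Finset.sum_le_sum fun k hk =>
          hmono k j (Finset.mem_Ioc.1 hk).2 (hT j (Finset.mem_filter.1 hj).1)
    _ = ∑ k ∈ (T.filter (M ≤ ·)).biUnion (fun j => Finset.Ioc (j - M) j), p k :=
        (Finset.sum_biUnion hdisj).symm
    _ ≤ ∑ j ∈ Finset.range n, p j := by
        refine Finset.sum_le_sum_of_subset_of_nonneg ?_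
          fun j hj _ => hnn j (Finset.mem_range.1 hj)
        intro k hk
        obtain ⟨j, hj, hkj⟩ := Finset.mem_biUnion.1 hk
        exact Finset.mem_range.2
          ((Finset.mem_Ioc.1 hkj).2.trans_lt (hT j (Finset.mem_filter.1 hj).1))

theorem sum_filter_lt_le_of_modEq {n M : ℕ} {p : ℕ → ℝ} {C : ℝ} (hC : 0 ≤ C)
    (hpC : ∀ j < n, p j ≤ C) {T : Finset ℕ}
    (hT : ∀ j ∈ T, j < n) (hmod : ∀ j ∈ T, ∀ k ∈ T, j ≡ k [MOD M]) :
    ∑ j ∈ T with ¬ M ≤ j, p j ≤ C := by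
  have hcard : (T.filter (¬ M ≤ ·)).card ≤ 1 := by
    refine Finset.card_le_one.2 fun j hj k hk => ?_
    rw [Finset.mem_filter, not_le] at hj hk
    exact (hmod j hj.1 k hk.1).eq_of_lt_of_lt hj.2 hk.2
  calc ∑ j ∈ T with ¬ M ≤ j, p j ≤ (T.filter (¬ M ≤ ·)).card • C :=
        Finset.sum_le_card_nsmul _ _ _ fun j hj => hpC j (hT j (Finset.mem_filter.1 hj).1)
    _ ≤ C := by
        rw [nsmul_eq_mul]
        exact mul_le_of_le_one_left hC (by exact_mod_cast hcard)

/-- For `n` jobs with non-increasing non-negative sizes, a nonempty set `S`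
of machines, `0 < α < 1`, `b = max(⌊α|S|⌋, 1)` bins produced by the binning function, and
any injective map `h` from the bins into `S`, the assignment sending each job `j` to
machine `h(i)`, where `i` is the bin containing `j`, has makespan at most
`(1 + 2/α)·OPT`, where `OPT` is the optimal makespan for assigning the `n` jobs to the
machines of `S`. -/
theorem binhash_makespan
    (m n : ℕ) (p : ℕ → ℝ)
    (hnn : ∀ j < n, 0 ≤ p j)
    (hmono : ∀ j k : ℕ, j ≤ k → k < n → p k ≤ p j)
    (S : Finset (Fin m)) (hS : S.Nonempty)
    (α : ℝ) (hα0 : 0 < α) (hα1 : α < 1)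
    (b : ℕ) (hb : b = max (Nat.floor (α * (S.card : ℝ))) 1)
    (OPT : ℝ)
    (hOPT : IsLeast {C : ℝ | ∃ g : Fin n → Fin m, (∀ j, g j ∈ S) ∧
      ∀ i : Fin m, ∑ j ∈ Finset.univ.filter (fun j => g j = i), p (j : ℕ) ≤ C} OPT)
    (h : Fin b → Fin m) (hinj : Function.Injective h) (hhS : ∀ l, h l ∈ S)
    (F : ℕ → Fin m) (hF : ∀ l : Fin b, ∀ j ∈ binB n b (l : ℕ), F j = h l) :
    ∀ i : Fin m, ∑ j ∈ (Finset.range n).filter (fun j => F j = i), p j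
      ≤ (1 + 2 / α) * OPT := by
  obtain ⟨⟨g, hgS, hg⟩, -⟩ := hOPT
  have hb0 : 0 < b := by omega
  have hcard : (0 : ℝ) < S.card := by exact_mod_cast hS.card_pos
  have hOPT0 : 0 ≤ OPT := by
    obtain ⟨s, -⟩ := hS
    exact (Finset.sum_nonneg fun j _ => hnn _ (Fin.is_lt j)).trans (hg s)
  have hpOPT : ∀ j < n, p j ≤ OPT := fun j hj =>
    (Finset.single_le_sum (s := Finset.univ.filter fun k => g k = g ⟨j, hj⟩)
      (f := fun k : Fin n => p k) (fun k _ => hnn k k.2)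
      (Finset.mem_filter.2 ⟨Finset.mem_univ ⟨j, hj⟩, rfl⟩)).trans (hg (g ⟨j, hj⟩))
  have htotal : ∑ j ∈ Finset.range n, p j ≤ S.card * OPT := by
    rw [Finset.sum_range, ← Finset.sum_fiberwise_of_maps_to (fun j _ => hgS j), ← nsmul_eq_mul]
    exact Finset.sum_le_card_nsmul _ _ _ fun s _ => hg s
  have hM : α * S.card < 2 * (2 ^ Nat.log 2 b : ℕ) := by
    have h1 : b + 1 ≤ 2 * 2 ^ Nat.log 2 b := by
      rw [← pow_succ']
      exact Nat.lt_pow_succ_log_self one_lt_two b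
    have h2 : Nat.floor (α * (S.card : ℝ)) ≤ b := hb ▸ le_max_left _ _
    calc α * S.card < (Nat.floor (α * (S.card : ℝ)) : ℝ) + 1 := Nat.lt_floor_add_one _
      _ ≤ 2 * (2 ^ Nat.log 2 b : ℕ) := by exact_mod_cast (by omega)
  intro i
  set T := (Finset.range n).filter (fun j => F j = i)
  have hT : ∀ j ∈ T, j < n := fun j hj => Finset.mem_range.1 (Finset.mem_filter.1 hj).1
  have hmod : ∀ j ∈ T, ∀ k ∈ T, j ≡ k [MOD 2 ^ Nat.log 2 b] := by
    intro j hj k hk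
    obtain ⟨l, hl, hjl⟩ := exists_mem_binB hb0 (hT j hj)
    obtain ⟨l', hl', hkl⟩ := exists_mem_binB hb0 (hT k hk)
    have hll : (⟨l, hl⟩ : Fin b) = ⟨l', hl'⟩ := hinj <| by
      rw [← hF ⟨l, hl⟩ j hjl, ← hF ⟨l', hl'⟩ k hkl, (Finset.mem_filter.1 hj).2,
        (Finset.mem_filter.1 hk).2]
    obtain rfl : l = l' := congrArg Fin.val hll
    exact (modEq_of_mem_binB hb0 hjl).trans (modEq_of_mem_binB hb0 hkl).symm
  have hlarge := (mul_sum_filter_le_sum_range hnn hmono hT hmod).trans htotal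
  have hsmall := sum_filter_lt_le_of_modEq hOPT0 hpOPT hT hmod
  have hX : ∑ j ∈ T with 2 ^ Nat.log 2 b ≤ j, p j ≤ 2 / α * OPT := by
    have hX0 : 0 ≤ ∑ j ∈ T with 2 ^ Nat.log 2 b ≤ j, p j :=
      Finset.sum_nonneg fun j hj => hnn j (hT j (Finset.mem_filter.1 hj).1)
    rw [div_mul_eq_mul_div, le_div_iff₀ hα0]
    refine le_of_mul_le_mul_left ?_ hcard
    linarith [mul_le_mul_of_nonneg_right hM.le hX0]
  rw [← Finset.sum_filter_add_sum_filter_not T (2 ^ Nat.log 2 b ≤ ·)]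
  linarith
end
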